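/- Let {G_n}_{n≥1} be a sequence of nonamenable, transitive, locally finite, infinite connected graphs converging locally to a nonamenable, transitive, locally finite, infinite connected graph G that satisfies Assumption 1. For each n let r_n = sup{r ∈ ℤ_{≥0} : B_{G_n}(v_n, r) and B_G(v, r) are isomorphic as rooted graphs}, where v_n (resp. v) is an arbitrary vertex of G_n (resp. G). If λ₁(G_n)²·r_n → ∞ as n → ∞, then p_c(G_n) → p_c(G) as n → ∞. -/

import Mathlib

/-!
Statement 0 (He–Xiang–Zhu, Theorem 1): locality of the percolation critical
probability for uniformly nonamenable sequences of transitive graphs whose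
local limit satisfies Assumption 1.
-/

open Filter

namespace Loc

variable {V : Type*}

/-- `x` lies in the ball of radius `n` around `v` in `G` (graph distance via walks). -/
def inBall (G : SimpleGraph V) (v : V) (n : ℕ) (x : V) : Prop :=
  ∃ w : G.Walk v x, w.length ≤ n

/-- `x` lies on the sphere `∂B_G(u,n) = B_G(u,n) \ B_G(u,n-1)`. -/
def onSphere (G : SimpleGraph V) (u : V) (n : ℕ) (x : V) : Prop :=
  inBall G u n x ∧ ¬ inBall G u (n - 1) x

/-- `x` and `y` are joined by a walk of `G` all of whose edges lie in the finite set `S`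
(the set of open edges). -/
def connectedVia (G : SimpleGraph V) (S : Finset (Sym2 V)) (x y : V) : Prop :=
  ∃ w : G.Walk x y, ∀ e ∈ w.edges, e ∈ S

open Classical in
/-- The probability, under i.i.d. Bernoulli(`p`) bond percolation on the finite edge set `E`,
of the event `A`; a configuration is recorded as its (finite) set of open edges. -/
noncomputable def cylProb (p : ℝ) (E : Finset (Sym2 V)) (A : Finset (Sym2 V) → Prop) : ℝ :=
  ∑ S ∈ E.powerset, if A S then p ^ S.card * (1 - p) ^ (E.card - S.card) else 0

/-- The probability of an increasing event `A` (an event witnessed by finitely many open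
edges) under Bernoulli(`p`) bond percolation: the supremum over finite edge sets of the
finite-volume probabilities. -/
noncomputable def prob (p : ℝ) (A : Finset (Sym2 V) → Prop) : ℝ :=
  ⨆ E : Finset (Sym2 V), cylProb p E A

/-- `θ_G(p)` at the vertex `v`: the probability that `v` lies in an infinite open cluster,
i.e. the infimum over `n` of the probability that `v` is connected to the complement of
the ball of radius `n`. -/
noncomputable def theta (G : SimpleGraph V) (p : ℝ) (v : V) : ℝ :=
  ⨅ n : ℕ, prob p (fun S => ∃ x : V, ¬ inBall G v n x ∧ connectedVia G S v x)

/-- The critical probability of Bernoulli bond percolation on `G`: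
`p_c(G) = inf {p ∈ [0,1] : ℙ_p(∃ infinite open cluster) > 0}`.  (For a countable graph
there is an infinite cluster with positive probability iff `θ` is positive at some vertex.) -/
noncomputable def pc (G : SimpleGraph V) : ℝ :=
  sInf {p : ℝ | 0 ≤ p ∧ p ≤ 1 ∧ ∃ v : V, 0 < theta G p v}

/-- `b_n(x,u)`: the probability that `x` is connected to `u` by open edges inside the
ball `B_G(u,n)` under Bernoulli(`p`) bond percolation. -/
noncomputable def bconn (G : SimpleGraph V) (p : ℝ) (u : V) (n : ℕ) (x : V) : ℝ :=
  prob p (fun S => ∃ w : G.Walk u x, (∀ e ∈ w.edges, e ∈ S) ∧ ∀ y ∈ w.support, inBall G u n y)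

/-- `μ_n(x)`: the harmonic measure at `x ∈ ∂B_G(u,n)` of simple random walk on the
`d`-regular graph `G` started at `u`, i.e. `∑_γ d^{-|γ|}`, summed over all walks `γ`
from `u` to `x` whose vertices, except the last one, lie in `B_G(u,n-1)`. -/
noncomputable def harm (G : SimpleGraph V) (d : ℕ) (u : V) (n : ℕ) (x : V) : ℝ :=
  ∑' w : {w : G.Walk u x // ∀ y ∈ w.support.dropLast, inBall G u (n - 1) y},
    ((d : ℝ))⁻¹ ^ (w : G.Walk u x).length

/-- `λ₁(G)`: the bottom of the spectrum of `I - P` for simple random walk on `G`,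
computed in `ℓ²(V, deg)`; the infimum of the Rayleigh quotients of finitely supported
nonzero functions.  `G` is nonamenable iff `0 < lambda1 G`. -/
noncomputable def lambda1 (G : SimpleGraph V) : ℝ :=
  sInf {r : ℝ | ∃ f : V →₀ ℝ, f ≠ 0 ∧
    r = (∑ x ∈ f.support,
          (((G.neighborSet x).ncard : ℝ) * f x - ∑' y : G.neighborSet x, f (y : V)) * f x) /
        (∑ x ∈ f.support, ((G.neighborSet x).ncard : ℝ) * f x ^ 2)}

/-- `G` is vertex-transitive. -/
def IsTransitive (G : SimpleGraph V) : Prop :=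
  ∀ u v : V, ∃ φ : G ≃g G, φ u = v

/-- The balls `B_G(v,R)` and `B_H(w,R)` are isomorphic as rooted graphs. -/
def BallIso {W : Type*} (G : SimpleGraph V) (H : SimpleGraph W) (v : V) (w : W) (R : ℕ) :
    Prop :=
  ∃ φ : {x : V // inBall G v R x} ≃ {y : W // inBall H w R y},
    (φ ⟨v, ⟨SimpleGraph.Walk.nil, by simp⟩⟩).1 = w ∧
    ∀ a b : {x : V // inBall G v R x}, G.Adj a.1 b.1 ↔ H.Adj (φ a).1 (φ b).1

/-- The sequence of transitive graphs `G n` converges locally to the transitive graph `H`: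
for every radius `R` there is `N` such that for `n ≥ N` all `R`-balls of `G n` are
isomorphic, as rooted graphs, to the `R`-balls of `H`. -/
def ConvergesLocally {Vn : ℕ → Type*} {W : Type*} (G : ∀ n, SimpleGraph (Vn n))
    (H : SimpleGraph W) : Prop :=
  ∀ R : ℕ, ∃ N : ℕ, ∀ n, N ≤ n → ∀ (vn : Vn n) (w : W), BallIso (G n) H vn w R

/-- Assumption 1(i): the harmonic measures on the spheres `∂B_G(u,n)` are roughly uniform,
with constants independent of `u` and `n`. -/
def Assumption1i (G : SimpleGraph V) (d : ℕ) : Prop :=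
  ∃ c C : ℝ, 0 < c ∧ 0 < C ∧ ∀ (u : V) (n : ℕ), 1 ≤ n → ∀ x y : V,
    onSphere G u n x → onSphere G u n y →
      c * harm G d u n y ≤ harm G d u n x ∧ harm G d u n x ≤ C * harm G d u n y

/-- Assumption 1(ii): for every `p ∈ (p_c(G), 1)` the in-ball connection probabilities
`b_n(·,u)` on the spheres `∂B_G(u,n)` are roughly uniform, with constants depending only
on `p`. -/
def Assumption1ii (G : SimpleGraph V) : Prop :=
  ∀ p : ℝ, pc G < p → p < 1 →
    ∃ c₁ c₂ : ℝ, 0 < c₁ ∧ 0 < c₂ ∧ ∀ (u : V) (n : ℕ), 1 ≤ n → ∀ x y : V,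
      onSphere G u n x → onSphere G u n y →
        c₁ * bconn G p u n y ≤ bconn G p u n x ∧ bconn G p u n x ≤ c₂ * bconn G p u n y

section
open Finset

variable {α : Type*}

/-- Expectation of `f` under Bernoulli(`p`) percolation on the finite set `E`. -/
noncomputable def Ex (p : ℝ) (E : Finset α) (f : Finset α → ℝ) : ℝ :=
  ∑ S ∈ E.powerset, p ^ S.card * (1 - p) ^ (E.card - S.card) * f S

lemma Ex_empty (p : ℝ) (f : Finset α → ℝ) : Ex p ∅ f = f ∅ := by simp [Ex]

lemma Ex_insert [DecidableEq α] (p : ℝ) {E : Finset α} {e : α} (he : e ∉ E) (f : Finset α → ℝ) :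
    Ex p (insert e E) f = p * Ex p E (fun S => f (insert e S)) + (1 - p) * Ex p E f := by
  unfold Ex
  rw [Finset.sum_powerset_insert he, add_comm, Finset.mul_sum, Finset.mul_sum]
  congr 1
  · refine Finset.sum_congr rfl fun S hS => ?_
    have hS' := Finset.mem_powerset.1 hS
    rw [Finset.card_insert_of_notMem he, Finset.card_insert_of_notMem (fun h => he (hS' h)),
      Nat.add_sub_add_right, pow_succ]
    ring
  · refine Finset.sum_congr rfl fun S hS => ?_
    have hS' := Finset.card_le_card (Finset.mem_powerset.1 hS)
    rw [Finset.card_insert_of_notMem he, Nat.sub_add_comm hS', pow_succ]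
    ring

lemma Ex_congr {p : ℝ} {E : Finset α} {f g : Finset α → ℝ} (h : ∀ S ⊆ E, f S = g S) :
    Ex p E f = Ex p E g :=
  Finset.sum_congr rfl fun S hS => by rw [h S (Finset.mem_powerset.1 hS)]

lemma Ex_mono {p : ℝ} (h0 : 0 ≤ p) (h1 : p ≤ 1) {E : Finset α} {f g : Finset α → ℝ}
    (h : ∀ S ⊆ E, f S ≤ g S) : Ex p E f ≤ Ex p E g :=
  Finset.sum_le_sum fun S hS => by
    have := sub_nonneg.2 h1
    exact mul_le_mul_of_nonneg_left (h S (Finset.mem_powerset.1 hS)) (by positivity)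

lemma Ex_const (p : ℝ) (E : Finset α) (c : ℝ) : Ex p E (fun _ => c) = c := by
  classical
  induction E using Finset.induction_on with
  | empty => simp [Ex_empty]
  | insert e E he ih => rw [Ex_insert p he, ih]; ring

lemma Ex_nonneg {p : ℝ} (h0 : 0 ≤ p) (h1 : p ≤ 1) {E : Finset α} {f : Finset α → ℝ}
    (h : ∀ S ⊆ E, 0 ≤ f S) : 0 ≤ Ex p E f := by
  simpa [Ex_const] using Ex_mono h0 h1 (f := fun _ => 0) h

lemma Ex_add (p : ℝ) (E : Finset α) (f g : Finset α → ℝ) :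
    Ex p E (fun S => f S + g S) = Ex p E f + Ex p E g := by
  simp [Ex, mul_add, Finset.sum_add_distrib]

lemma Ex_sub (p : ℝ) (E : Finset α) (f g : Finset α → ℝ) :
    Ex p E (fun S => f S - g S) = Ex p E f - Ex p E g := by
  simp [Ex, mul_sub, Finset.sum_sub_distrib]

lemma Ex_const_mul (p : ℝ) (E : Finset α) (c : ℝ) (f : Finset α → ℝ) :
    Ex p E (fun S => c * f S) = c * Ex p E f := by
  simp only [Ex, Finset.mul_sum]
  exact Finset.sum_congr rfl fun S _ => by ring

lemma Ex_mul_const (p : ℝ) (E : Finset α) (c : ℝ) (f : Finset α → ℝ) :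
    Ex p E (fun S => f S * c) = Ex p E f * c := by
  simp only [Ex, Finset.sum_mul]
  exact Finset.sum_congr rfl fun S _ => by ring

lemma Ex_sum {ι : Type*} (p : ℝ) (E : Finset α) (s : Finset ι) (f : ι → Finset α → ℝ) :
    Ex p E (fun S => ∑ i ∈ s, f i S) = ∑ i ∈ s, Ex p E (f i) := by
  simp only [Ex, Finset.mul_sum]
  exact Finset.sum_comm

lemma Ex_union [DecidableEq α] (p : ℝ) {E₁ E₂ : Finset α} (h : Disjoint E₁ E₂) (f : Finset α → ℝ) :
    Ex p (E₁ ∪ E₂) f = Ex p E₁ (fun S₁ => Ex p E₂ (fun S₂ => f (S₁ ∪ S₂))) := by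
  induction E₁ using Finset.induction_on generalizing f with
  | empty => simp [Ex_empty]
  | insert e E he ih =>
    rw [Finset.disjoint_insert_left] at h
    rw [Finset.insert_union, Ex_insert p (by simp [he, h.1]), Ex_insert p he, ih h.2, ih h.2]
    simp only [Finset.insert_union]

lemma Ex_restrict [DecidableEq α] (p : ℝ) {E' E : Finset α} (h : E' ⊆ E) (f : Finset α → ℝ) :
    Ex p E (fun S => f (S ∩ E')) = Ex p E' f := by
  have : E = E' ∪ E \ E' := (Finset.union_sdiff_of_subset h).symm
  rw [this, Ex_union p Finset.disjoint_sdiff]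
  refine Ex_congr fun S hS => ?_
  rw [← Ex_const p (E \ E') (f S)]
  refine Ex_congr fun T hT => ?_
  congr 1
  ext x
  have := @hS x
  have := @hT x
  simp only [Finset.mem_inter, Finset.mem_union, Finset.mem_sdiff] at *
  tauto

lemma Ex_insert_le [DecidableEq α] {p : ℝ} (h0 : 0 ≤ p) (h1 : p ≤ 1) {E : Finset α} {e : α} (he : e ∈ E)
    {f : Finset α → ℝ} (hf : ∀ S, 0 ≤ f S) :
    p * Ex p E (fun S => f (insert e S)) ≤ Ex p E f := by
  have hE : E = insert e (E.erase e) := (Finset.insert_erase he).symm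
  have hn : e ∉ E.erase e := Finset.notMem_erase e E
  have h2 : Ex p E (fun S => f (insert e S)) = Ex p (E.erase e) (fun S => f (insert e S)) := by
    rw [hE, Ex_insert p (by simp)]
    simp only [Finset.insert_idem, Finset.erase_insert hn]
    ring
  rw [h2]
  conv_rhs => rw [hE, Ex_insert p hn]
  have := mul_nonneg (sub_nonneg.2 h1) (Ex_nonneg h0 h1 (E := E.erase e) (f := f) fun S _ => hf S)
  linarith

lemma Ex_hasDerivAt [DecidableEq α] (p : ℝ) (E : Finset α) (f : Finset α → ℝ) :
    HasDerivAt (fun p => Ex p E f)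
      (∑ e ∈ E, Ex p (E.erase e) (fun S => f (insert e S) - f S)) p := by
  induction E using Finset.induction_on generalizing f with
  | empty => simpa [Ex_empty] using hasDerivAt_const p (f ∅)
  | insert e E he ih =>
    have h1 := ((hasDerivAt_id p).fun_mul (ih (fun S => f (insert e S)))).fun_add
      (((hasDerivAt_const p (1 : ℝ)).fun_sub (hasDerivAt_id p)).fun_mul (ih f))
    have h2 : (fun p => Ex p (insert e E) f) = (fun p => id p * Ex p E (fun S => f (insert e S))
        + (1 - id p) * Ex p E f) := by
      funext q; exact Ex_insert q he f
    rw [h2]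
    refine HasDerivAt.congr_deriv h1 ?_
    rw [Finset.sum_insert he, Finset.erase_insert he, Ex_sub]
    have h3 : ∀ a ∈ E, Ex p ((insert e E).erase a) (fun S => f (insert a S) - f S) =
        p * Ex p (E.erase a) (fun S => f (insert e (insert a S)) - f (insert e S)) +
        (1 - p) * Ex p (E.erase a) (fun S => f (insert a S) - f S) := by
      intro a ha
      have hne : e ≠ a := fun h => he (h ▸ ha)
      rw [Finset.erase_insert_of_ne hne, Ex_insert p (fun h => he (Finset.mem_of_mem_erase h))]
      simp only [Finset.insert_comm a e]
    rw [Finset.sum_congr rfl h3, Finset.sum_add_distrib, ← Finset.mul_sum, ← Finset.mul_sum]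
    simp only [id]
    ring

lemma Ex_mono_p {p q : ℝ} (h0 : 0 ≤ p) (hpq : p ≤ q) (h1 : q ≤ 1) (E : Finset α)
    {f : Finset α → ℝ} (hf : Monotone f) : Ex p E f ≤ Ex q E f := by
  classical
  induction E using Finset.induction_on generalizing f with
  | empty => simp [Ex_empty]
  | insert e E he ih =>
    rw [Ex_insert p he, Ex_insert q he]
    have h2 := ih hf
    have h3 := @ih (fun S => f (insert e S)) (fun S T h => hf (Finset.insert_subset_insert e h))
    have h4 : Ex q E f ≤ Ex q E (fun S => f (insert e S)) :=
      Ex_mono (h0.trans hpq) h1 fun S _ => hf (Finset.subset_insert e S)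
    nlinarith

lemma Ex_mono_set {p : ℝ} (h0 : 0 ≤ p) (h1 : p ≤ 1) {E' E : Finset α} (h : E' ⊆ E)
    {f : Finset α → ℝ} (hf : Monotone f) : Ex p E' f ≤ Ex p E f := by
  classical
  rw [← Ex_restrict p h]
  exact Ex_mono h0 h1 fun S _ => hf Finset.inter_subset_left

lemma Ex_image [DecidableEq α] {β : Type*} [DecidableEq β] (p : ℝ) (E : Finset α) (g : α → β) (hg : Set.InjOn g E)
    (f : Finset β → ℝ) : Ex p (E.image g) f = Ex p E (fun S => f (S.image g)) := by
  induction E using Finset.induction_on generalizing f with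
  | empty => simp [Ex_empty]
  | insert e E he ih =>
    have hE : Set.InjOn g E := hg.mono (by simp)
    have hn : g e ∉ E.image g := by
      intro h
      obtain ⟨a, ha, hae⟩ := Finset.mem_image.1 h
      have := hg (by simp [ha]) (by simp) hae
      exact he (this ▸ ha)
    rw [Finset.image_insert, Ex_insert p hn, Ex_insert p he, ih hE, ih hE]
    simp only [Finset.image_insert]

end

section
open scoped Classical
open Finset

variable {V : Type*}

/-- `y` is joined to `x` by edges of `S`. -/
def reach (S : Finset (Sym2 V)) (x y : V) : Prop :=
  Relation.ReflTransGen (fun a b => s(a, b) ∈ S) x y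

lemma reach.refl (S : Finset (Sym2 V)) (x : V) : reach S x x := Relation.ReflTransGen.refl

lemma reach.trans {S : Finset (Sym2 V)} {x y z : V} (h : reach S x y) (h' : reach S y z) :
    reach S x z := Relation.ReflTransGen.trans h h'

lemma reach.tail {S : Finset (Sym2 V)} {x y z : V} (h : reach S x y) (h' : s(y, z) ∈ S) :
    reach S x z := Relation.ReflTransGen.tail h h'

lemma reach.symm {S : Finset (Sym2 V)} {x y : V} (h : reach S x y) : reach S y x := by
  induction h with
  | refl => exact reach.refl _ _
  | tail _ h ih =>
    exact Relation.ReflTransGen.head (by rwa [Sym2.eq_swap]) ih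

lemma reach.mono {S T : Finset (Sym2 V)} (hST : S ⊆ T) {x y : V} (h : reach S x y) :
    reach T x y := Relation.ReflTransGen.mono (fun _ _ h => hST h) _ _ h

/-- The set of vertices joined to `B` by edges of `S`. -/
noncomputable def clu (S : Finset (Sym2 V)) (B : Finset V) : Finset V :=
  (B ∪ S.biUnion Sym2.toFinset).filter fun x => ∃ b ∈ B, reach S b x

lemma mem_clu {S : Finset (Sym2 V)} {B : Finset V} {x : V} :
    x ∈ clu S B ↔ ∃ b ∈ B, reach S b x := by
  simp only [clu, mem_filter, and_iff_right_iff_imp]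
  rintro ⟨b, hb, h⟩
  rcases Relation.ReflTransGen.cases_tail h with h | ⟨c, -, h⟩
  · subst h; exact mem_union_left _ hb
  · refine mem_union_right _ (mem_biUnion.2 ⟨_, h, by simp⟩)

lemma mem_clu_singleton {S : Finset (Sym2 V)} {v x : V} : x ∈ clu S {v} ↔ reach S v x := by
  simp [mem_clu]

lemma subset_clu (S : Finset (Sym2 V)) (B : Finset V) : B ⊆ clu S B :=
  fun b hb => mem_clu.2 ⟨b, hb, reach.refl _ _⟩

lemma clu_mono {S T : Finset (Sym2 V)} (h : S ⊆ T) (B : Finset V) : clu S B ⊆ clu T B :=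
  fun _ hx => by
    obtain ⟨b, hb, hr⟩ := mem_clu.1 hx
    exact mem_clu.2 ⟨b, hb, hr.mono h⟩

lemma clu_eq_of_agree {S S' : Finset (Sym2 V)} {A B : Finset V}
    (h : ∀ e, (∃ a ∈ A, a ∈ e) → (e ∈ S ↔ e ∈ S')) (hA : clu S B = A) : clu S' B = A := by
  have hstep : ∀ a c, a ∈ A → (s(a, c) ∈ S ↔ s(a, c) ∈ S') := fun a c ha =>
    h _ ⟨a, ha, Sym2.mem_mk_left a c⟩
  ext x
  constructor
  · intro hx
    obtain ⟨b, hb, hr⟩ := mem_clu.1 hx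
    clear hx
    induction hr with
    | refl => exact hA ▸ subset_clu S B hb
    | tail _ hs ih =>
      rw [← hstep _ _ ih] at hs
      rw [← hA] at ih ⊢
      obtain ⟨b', hb', hr'⟩ := mem_clu.1 ih
      exact mem_clu.2 ⟨b', hb', hr'.tail hs⟩
  · intro hx
    rw [← hA] at hx
    obtain ⟨b, hb, hr⟩ := mem_clu.1 hx
    clear hx
    refine mem_clu.2 ⟨b, hb, ?_⟩
    induction hr with
    | refl => exact reach.refl _ _
    | @tail y z hy hs ih =>
      have hyA : y ∈ A := hA ▸ mem_clu.2 ⟨b, hb, hy⟩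
      exact ih.tail ((hstep _ _ hyA).1 hs)

/-- The edges of `E` without endpoint in `A`. -/
noncomputable def del (E : Finset (Sym2 V)) (A : Finset V) : Finset (Sym2 V) :=
  E.filter fun e => ∀ a ∈ A, a ∉ e

lemma del_subset (E : Finset (Sym2 V)) (A : Finset V) : del E A ⊆ E := filter_subset _ _

lemma mem_del {E : Finset (Sym2 V)} {A : Finset V} {e : Sym2 V} :
    e ∈ del E A ↔ e ∈ E ∧ ∀ a ∈ A, a ∉ e := by simp [del]

lemma clu_union_eq_iff {E S₁ S₂ : Finset (Sym2 V)} {A B : Finset V} (h₂ : S₂ ⊆ del E A) :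
    clu (S₁ ∪ S₂) B = A ↔ clu S₁ B = A := by
  have : ∀ e, (∃ a ∈ A, a ∈ e) → (e ∈ S₁ ∪ S₂ ↔ e ∈ S₁) := by
    rintro e ⟨a, ha, hae⟩
    rw [mem_union, or_iff_left]
    exact fun h => (mem_del.1 (h₂ h)).2 a ha hae
  exact ⟨clu_eq_of_agree this, clu_eq_of_agree fun e he => (this e he).symm⟩

/-- Conditionally on the cluster of `B`, the edges not touching it are independent. -/
lemma Ex_decouple (p : ℝ) (E : Finset (Sym2 V)) (B : Finset V)
    (k : Finset V → Finset (Sym2 V) → ℝ) :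
    Ex p E (fun S => k (clu S B) (S ∩ del E (clu S B))) =
      Ex p E (fun S => Ex p (del E (clu S B)) (k (clu S B))) := by
  have key : ∀ (g : Finset V → Finset (Sym2 V) → ℝ),
      Ex p E (fun S => g (clu S B) S) = ∑ A ∈ E.powerset.image (fun S => clu S B),
        Ex p E (fun S => if clu S B = A then g A S else 0) := by
    intro g
    rw [← Ex_sum]
    refine Ex_congr fun S hS => ?_
    rw [sum_ite_eq, if_pos (mem_image_of_mem _ (mem_powerset.2 hS))]
  rw [key (fun A S => k A (S ∩ del E A)), key (fun A S => Ex p (del E A) (k A))]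
  refine sum_congr rfl fun A _ => ?_
  have hE : E = E \ del E A ∪ del E A := (sdiff_union_of_subset (del_subset E A)).symm
  have hd : Disjoint (E \ del E A) (del E A) := sdiff_disjoint
  have hu : ∀ f, Ex p E f =
      Ex p (E \ del E A) (fun S₁ => Ex p (del E A) (fun S₂ => f (S₁ ∪ S₂))) := by
    intro f
    conv_lhs => rw [hE]
    exact Ex_union p hd f
  rw [hu, hu]
  refine Ex_congr fun S₁ hS₁ => ?_
  have h1 : Ex p (del E A) (fun S₂ => if clu (S₁ ∪ S₂) B = A then Ex p (del E A) (k A) else 0)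
      = if clu S₁ B = A then Ex p (del E A) (k A) else 0 := by
    rw [← Ex_const p (del E A) (if clu S₁ B = A then Ex p (del E A) (k A) else 0)]
    refine Ex_congr fun S₂ hS₂ => ?_
    simp only [clu_union_eq_iff hS₂]
  rw [h1]
  have h2 : ∀ S₂ ⊆ del E A, (if clu (S₁ ∪ S₂) B = A then k A ((S₁ ∪ S₂) ∩ del E A) else 0) =
      if clu S₁ B = A then k A S₂ else 0 := by
    intro S₂ hS₂
    have : (S₁ ∪ S₂) ∩ del E A = S₂ := by
      ext e
      have := @hS₁ e
      have := @hS₂ e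
      simp only [mem_inter, mem_union, Finset.mem_sdiff] at *
      tauto
    simp only [clu_union_eq_iff hS₂, this]
  rw [Ex_congr h2]
  split_ifs
  · rfl
  · exact Ex_const _ _ _

/-- The oriented edges of `E` leading out of `A`. -/
noncomputable def bd (E : Finset (Sym2 V)) (A : Finset V) : Finset (V × V) :=
  (A ×ˢ E.biUnion Sym2.toFinset).filter fun q => q.2 ∉ A ∧ s(q.1, q.2) ∈ E

lemma mem_bd {E : Finset (Sym2 V)} {A : Finset V} {q : V × V} :
    q ∈ bd E A ↔ q.1 ∈ A ∧ q.2 ∉ A ∧ s(q.1, q.2) ∈ E := by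
  simp only [bd, mem_filter, mem_product]
  constructor
  · rintro ⟨⟨h1, -⟩, h2⟩; exact ⟨h1, h2⟩
  · rintro ⟨h1, h2⟩
    exact ⟨⟨h1, mem_biUnion.2 ⟨_, h2.2, by simp⟩⟩, h2⟩

lemma bd_injOn (E : Finset (Sym2 V)) (A : Finset V) :
    Set.InjOn (fun q : V × V => s(q.1, q.2)) (bd E A) := by
  rintro ⟨a, b⟩ h ⟨c, d⟩ h' he
  have h1 := mem_bd.1 (mem_coe.1 h)
  have h2 := mem_bd.1 (mem_coe.1 h')
  simp only [Sym2.eq_iff] at he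
  rcases he with ⟨rfl, rfl⟩ | ⟨rfl, rfl⟩
  · rfl
  · exact absurd h1.1 h2.2.1

/-- Lower bound for the derivative of the expectation of an increasing function of the cluster. -/
lemma deriv_Ex_clu_ge {p : ℝ} (h0 : 0 ≤ p) (h1 : p ≤ 1) (E : Finset (Sym2 V)) (B : Finset V)
    {F : Finset V → ℝ} (hF : Monotone F) :
    Ex p E (fun S => ∑ q ∈ bd E (clu S B), Ex p (del E (clu S B))
        (fun S' => F (clu S B ∪ clu S' {q.2}) - F (clu S B))) ≤
      ∑ e ∈ E, Ex p (E.erase e) (fun S => F (clu (insert e S) B) - F (clu S B)) := by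
  have hdec := Ex_decouple p E B
    (fun A S' => ∑ q ∈ bd E A, (F (A ∪ clu S' {q.2}) - F A))
  simp only [Ex_sum] at hdec
  rw [← hdec]
  have hpos : ∀ e S, 0 ≤ F (clu (insert e S) B) - F (clu S B) := fun e S =>
    sub_nonneg.2 (hF (clu_mono (subset_insert e S) B))
  have hstep : Ex p E (fun S => ∑ e ∈ E, (F (clu (insert e S) B) - F (clu S B))) ≤
      ∑ e ∈ E, Ex p (E.erase e) (fun S => F (clu (insert e S) B) - F (clu S B)) := by
    rw [Ex_sum]
    refine sum_le_sum fun e he => ?_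
    conv_lhs => rw [← insert_erase he, Ex_insert p (notMem_erase e E)]
    simp only [insert_idem, sub_self, Ex_const]
    have := Ex_nonneg h0 h1 (E := E.erase e) (fun S _ => hpos e S)
    nlinarith
  refine le_trans (Ex_mono h0 h1 fun S hS => ?_) hstep
  have him : (bd E (clu S B)).image (fun q : V × V => s(q.1, q.2)) ⊆ E := by
    intro e he
    obtain ⟨q, hq, rfl⟩ := mem_image.1 he
    exact (mem_bd.1 hq).2.2
  refine le_trans ?_ (sum_le_sum_of_subset_of_nonneg him fun e _ _ => hpos e S)
  rw [sum_image (bd_injOn E (clu S B))]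
  refine sum_le_sum fun q hq => sub_le_sub_right (hF ?_) _
  intro x hx
  rcases mem_union.1 hx with hx | hx
  · exact clu_mono (subset_insert _ _) B hx
  · obtain ⟨b, hb, hr⟩ := mem_clu.1 (mem_bd.1 hq).1
    have h2 := mem_clu_singleton.1 hx
    refine mem_clu.2 ⟨b, hb, ((hr.mono (subset_insert _ _)).tail (mem_insert_self _ _)).trans ?_⟩
    exact h2.mono (inter_subset_left.trans (subset_insert _ _))

end

section
open scoped Classical
open Finset

variable {V W : Type*}

lemma reach_image {f : V → W} {S : Finset (Sym2 V)} {x y : V} (h : reach S x y) :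
    reach (S.image (Sym2.map f)) (f x) (f y) := by
  induction h with
  | refl => exact reach.refl _ _
  | tail _ h ih => exact ih.tail (mem_image.2 ⟨_, h, rfl⟩)

lemma reach_of_reach_image {f : V → W} {U : Finset V} (hf : Set.InjOn f U)
    {S : Finset (Sym2 V)} (hS : S ⊆ U.sym2) {v : V} (hv : v ∈ U) {z : W}
    (h : reach (S.image (Sym2.map f)) (f v) z) : ∃ x ∈ U, f x = z ∧ reach S v x := by
  induction h with
  | refl => exact ⟨v, hv, rfl, reach.refl _ _⟩
  | @tail y z _ h ih =>
    obtain ⟨x, hx, rfl, hr⟩ := ih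
    obtain ⟨e, he, hez⟩ := mem_image.1 h
    induction e using Sym2.ind with
    | _ a b =>
      have hab := mk_mem_sym2_iff.1 (hS he)
      rw [Sym2.map_mk, Sym2.eq_iff] at hez
      rcases hez with ⟨h1, h2⟩ | ⟨h1, h2⟩
      · obtain rfl := hf hab.1 hx h1
        exact ⟨b, hab.2, h2, hr.tail he⟩
      · obtain rfl := hf hab.2 hx h2
        exact ⟨a, hab.1, h1, hr.tail (by rwa [Sym2.eq_swap])⟩

lemma clu_image {f : V → W} {U : Finset V} (hf : Set.InjOn f U)
    {S : Finset (Sym2 V)} (hS : S ⊆ U.sym2) {v : V} (hv : v ∈ U) :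
    clu (S.image (Sym2.map f)) {f v} = (clu S {v}).image f := by
  ext z
  rw [mem_clu_singleton, mem_image]
  constructor
  · intro h
    obtain ⟨x, -, rfl, hr⟩ := reach_of_reach_image hf hS hv h
    exact ⟨x, mem_clu_singleton.2 hr, rfl⟩
  · rintro ⟨x, hx, rfl⟩
    exact reach_image (mem_clu_singleton.1 hx)

lemma clu_subset {U : Finset V} {S : Finset (Sym2 V)} (hS : S ⊆ U.sym2) {B : Finset V}
    (hB : B ⊆ U) : clu S B ⊆ U := by
  intro x hx
  obtain ⟨b, hb, hr⟩ := mem_clu.1 hx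
  rcases Relation.ReflTransGen.cases_tail hr with h | ⟨c, -, h⟩
  · subst h; exact hB hb
  · exact (mk_mem_sym2_iff.1 (hS h)).2

/-- Cluster sizes are transported by maps which are injective on the relevant vertices. -/
lemma Ex_card_clu_image (p : ℝ) {f : V → W} {U : Finset V} (hf : Set.InjOn f U)
    {E : Finset (Sym2 V)} (hE : E ⊆ U.sym2) {v : V} (hv : v ∈ U) (F : ℕ → ℝ) :
    Ex p (E.image (Sym2.map f)) (fun S => F (clu S {f v}).card) =
      Ex p E (fun S => F (clu S {v}).card) := by
  rw [Ex_image]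
  · refine Ex_congr fun S hS => ?_
    rw [clu_image hf (hS.trans hE) hv, card_image_of_injOn]
    exact hf.mono (coe_subset.2 (clu_subset (hS.trans hE) (by simpa using hv)))
  · intro e he e' he' h
    have h1 := hE he
    have h2 := hE he'
    induction e using Sym2.ind with
    | _ a b =>
      induction e' using Sym2.ind with
      | _ a' b' =>
        rw [mk_mem_sym2_iff] at h1 h2
        rw [Sym2.map_mk, Sym2.map_mk, Sym2.eq_iff] at h
        rw [Sym2.eq_iff]
        rcases h with ⟨h3, h4⟩ | ⟨h3, h4⟩
        · exact Or.inl ⟨hf h1.1 h2.1 h3, hf h1.2 h2.2 h4⟩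
        · exact Or.inr ⟨hf h1.1 h2.2 h3, hf h1.2 h2.1 h4⟩

/-- The vertices of `A` and their neighbours. -/
noncomputable def nb (G : SimpleGraph V) (A : Finset V) : Finset V :=
  A ∪ A.biUnion fun a => if h : (G.neighborSet a).Finite then h.toFinset else ∅

lemma mem_nb {G : SimpleGraph V} (hlf : ∀ v, (G.neighborSet v).Finite) {A : Finset V} {x : V} :
    x ∈ nb G A ↔ x ∈ A ∨ ∃ a ∈ A, G.Adj a x := by
  simp [nb, hlf]

lemma subset_nb (G : SimpleGraph V) (A : Finset V) : A ⊆ nb G A := subset_union_left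

lemma inBall_zero {G : SimpleGraph V} {v x : V} : inBall G v 0 x ↔ x = v := by
  constructor
  · rintro ⟨w, hw⟩
    exact (SimpleGraph.Walk.eq_of_length_eq_zero (Nat.le_zero.1 hw)).symm
  · rintro rfl
    exact ⟨SimpleGraph.Walk.nil, by simp⟩

lemma inBall_succ {G : SimpleGraph V} {v x : V} {n : ℕ} :
    inBall G v (n + 1) x ↔ inBall G v n x ∨ ∃ a, inBall G v n a ∧ G.Adj a x := by
  constructor
  · rintro ⟨w, hw⟩
    rcases Nat.lt_or_ge w.length (n + 1) with h | h
    · exact Or.inl ⟨w, by omega⟩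
    · right
      have hnn : ¬ w.Nil := by
        rw [← SimpleGraph.Walk.length_eq_zero_iff]; omega
      refine ⟨w.penultimate, ⟨w.dropLast, ?_⟩, w.adj_penultimate hnn⟩
      have := w.length_dropLast_add_one hnn
      omega
  · rintro (⟨w, hw⟩ | ⟨a, ⟨w, hw⟩, h⟩)
    · exact ⟨w, by omega⟩
    · exact ⟨w.concat h, by simpa using hw⟩

lemma mem_nb_iterate {G : SimpleGraph V} (hlf : ∀ v, (G.neighborSet v).Finite) {A : Finset V}
    {n : ℕ} {x : V} : x ∈ (nb G)^[n] A ↔ ∃ a ∈ A, inBall G a n x := by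
  induction n generalizing x with
  | zero => simp [inBall_zero]
  | succ n ih =>
    rw [Function.iterate_succ_apply', mem_nb hlf]
    simp only [ih, inBall_succ]
    constructor
    · rintro (⟨a, ha, h⟩ | ⟨y, ⟨a, ha, h⟩, hy⟩)
      · exact ⟨a, ha, Or.inl h⟩
      · exact ⟨a, ha, Or.inr ⟨y, h, hy⟩⟩
    · rintro ⟨a, ha, h | ⟨y, h, hy⟩⟩
      · exact Or.inl ⟨a, ha, h⟩
      · exact Or.inr ⟨y, ⟨a, ha, h⟩, hy⟩

/-- The ball as a finite set. -/
noncomputable def bl (G : SimpleGraph V) (v : V) (n : ℕ) : Finset V := (nb G)^[n] {v}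

lemma mem_bl {G : SimpleGraph V} (hlf : ∀ v, (G.neighborSet v).Finite) {v x : V} {n : ℕ} :
    x ∈ bl G v n ↔ inBall G v n x := by
  simp [bl, mem_nb_iterate hlf]

lemma bl_succ (G : SimpleGraph V) (v : V) (n : ℕ) : bl G v (n + 1) = nb G (bl G v n) :=
  Function.iterate_succ_apply' _ _ _

lemma bl_mono (G : SimpleGraph V) (v : V) : Monotone (bl G v) :=
  monotone_nat_of_le_succ fun n => by rw [bl_succ]; exact subset_nb _ _

lemma self_mem_bl (G : SimpleGraph V) (v : V) (n : ℕ) : v ∈ bl G v n :=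
  bl_mono G v (Nat.zero_le n) (by simp [bl])

/-- The edges of `G` inside `A`. -/
noncomputable def eg (G : SimpleGraph V) (A : Finset V) : Finset (Sym2 V) :=
  A.sym2.filter (· ∈ G.edgeSet)

lemma mem_eg {G : SimpleGraph V} {A : Finset V} {x y : V} :
    s(x, y) ∈ eg G A ↔ x ∈ A ∧ y ∈ A ∧ G.Adj x y := by
  simp [eg, and_assoc]

lemma eg_subset_sym2 (G : SimpleGraph V) (A : Finset V) : eg G A ⊆ A.sym2 := filter_subset _ _

lemma eg_mono (G : SimpleGraph V) : Monotone (eg G) := fun _ _ h =>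
  filter_subset_filter _ (sym2_mono h)

lemma eg_image {G : SimpleGraph V} {H : SimpleGraph W} {f : V → W} {U : Finset V}
    (hadj : ∀ a ∈ U, ∀ b ∈ U, (G.Adj a b ↔ H.Adj (f a) (f b))) :
    (eg G U).image (Sym2.map f) = eg H (U.image f) := by
  ext e
  induction e using Sym2.ind with
  | _ a b =>
    rw [mem_eg]
    constructor
    · intro h
      obtain ⟨e, he, hab⟩ := mem_image.1 h
      induction e using Sym2.ind with
      | _ x y =>
        rw [mem_eg] at he
        have h1 := (hadj x he.1 y he.2.1).1 he.2.2
        rw [Sym2.map_mk, Sym2.eq_iff] at hab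
        rcases hab with ⟨rfl, rfl⟩ | ⟨rfl, rfl⟩
        · exact ⟨mem_image_of_mem _ he.1, mem_image_of_mem _ he.2.1, h1⟩
        · exact ⟨mem_image_of_mem _ he.2.1, mem_image_of_mem _ he.1, h1.symm⟩
    · rintro ⟨ha, hb, h⟩
      obtain ⟨x, hx, rfl⟩ := mem_image.1 ha
      obtain ⟨y, hy, rfl⟩ := mem_image.1 hb
      exact mem_image.2 ⟨s(x, y), mem_eg.2 ⟨hx, hy, (hadj x hx y hy).2 h⟩, rfl⟩

/-- The probability that the cluster of `v` in the ball of radius `s` has at least `M` vertices. -/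
noncomputable def rho (G : SimpleGraph V) (p : ℝ) (s M : ℕ) (v : V) : ℝ :=
  Ex p (eg G (bl G v s)) fun S => if M ≤ (clu S {v}).card then 1 else 0

lemma monotone_ind_card_clu (M : ℕ) (B : Finset V) :
    Monotone fun S : Finset (Sym2 V) => if M ≤ (clu S B).card then (1 : ℝ) else 0 := by
  intro S T h
  have := card_le_card (clu_mono h B)
  dsimp only
  split_ifs <;> first | (exfalso; omega) | norm_num

lemma rho_mono_p (G : SimpleGraph V) {p q : ℝ} (h0 : 0 ≤ p) (hpq : p ≤ q) (h1 : q ≤ 1) (s M : ℕ)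
    (v : V) : rho G p s M v ≤ rho G q s M v :=
  Ex_mono_p h0 hpq h1 _ (monotone_ind_card_clu M {v})

lemma rho_mono_radius (G : SimpleGraph V) {p : ℝ} (h0 : 0 ≤ p) (h1 : p ≤ 1) {s s' : ℕ}
    (h : s ≤ s') (M : ℕ) (v : V) : rho G p s M v ≤ rho G p s' M v :=
  Ex_mono_set h0 h1 (eg_mono G (bl_mono G v h)) (monotone_ind_card_clu M {v})

lemma rho_anti (G : SimpleGraph V) {p : ℝ} (h0 : 0 ≤ p) (h1 : p ≤ 1) (s : ℕ) {M M' : ℕ}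
    (h : M ≤ M') (v : V) : rho G p s M' v ≤ rho G p s M v :=
  Ex_mono h0 h1 fun S _ => by split_ifs <;> first | (exfalso; omega) | norm_num

lemma BallIso.image_bl {G : SimpleGraph V} {H : SimpleGraph W}
    (hG : ∀ v, (G.neighborSet v).Finite) (hH : ∀ v, (H.neighborSet v).Finite)
    {v : V} {w : W} {R : ℕ} (h : BallIso G H v w R) :
    ∃ f : V → W, f v = w ∧ Set.InjOn f (bl G v R) ∧
      (∀ a ∈ bl G v R, ∀ b ∈ bl G v R, (G.Adj a b ↔ H.Adj (f a) (f b))) ∧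
      ∀ s ≤ R, (bl G v s).image f = bl H w s := by
  obtain ⟨φ, hv, hadj⟩ := h
  let f : V → W := fun x => if h : inBall G v R x then (φ ⟨x, h⟩).1 else w
  have hf : ∀ x (h : inBall G v R x), f x = (φ ⟨x, h⟩).1 := fun x h => by simp [f, h]
  have hfv : f v = w := (hf v _).trans hv
  have hadj' : ∀ a ∈ bl G v R, ∀ b ∈ bl G v R, (G.Adj a b ↔ H.Adj (f a) (f b)) := by
    intro a ha b hb
    rw [mem_bl hG] at ha hb
    rw [hf a ha, hf b hb]
    exact hadj ⟨a, ha⟩ ⟨b, hb⟩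
  refine ⟨f, hfv, ?_, hadj', ?_⟩
  · intro a ha b hb hab
    rw [mem_coe, mem_bl hG] at ha hb
    rw [hf a ha, hf b hb] at hab
    exact congrArg Subtype.val (φ.injective (Subtype.ext hab))
  · intro s hs
    induction s with
    | zero => simp [bl, hfv]
    | succ s ih =>
      have ih := ih (by omega)
      have hsub : bl G v s ⊆ bl G v R := bl_mono G v (by omega)
      ext y
      rw [mem_image]
      constructor
      · rintro ⟨x, hx, rfl⟩
        have hxR := bl_mono G v hs hx
        rw [bl_succ, mem_nb hG] at hx
        rw [bl_succ, mem_nb hH, ← ih]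
        rcases hx with hx | ⟨a, ha, hax⟩
        · exact Or.inl (mem_image_of_mem f hx)
        · exact Or.inr ⟨f a, mem_image_of_mem f ha, (hadj' a (hsub ha) x hxR).1 hax⟩
      · intro hy
        have hyR := (mem_bl hH).1 (bl_mono H w hs hy)
        obtain ⟨⟨x, hxR⟩, hx⟩ := φ.surjective ⟨y, hyR⟩
        have hfx : f x = y := by rw [hf x hxR, hx]
        have hxR' := (mem_bl hG).2 hxR
        rw [bl_succ, mem_nb hH, ← ih] at hy
        refine ⟨x, ?_, hfx⟩
        rw [bl_succ, mem_nb hG]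
        rcases hy with hy | ⟨b, hb, hby⟩
        · obtain ⟨a, ha, hay⟩ := mem_image.1 hy
          rw [hf a ((mem_bl hG).1 (hsub ha)), ← hfx, hf x hxR] at hay
          have := congrArg Subtype.val (φ.injective (Subtype.ext hay))
          dsimp only at this
          exact Or.inl (this ▸ ha)
        · obtain ⟨a, ha, rfl⟩ := mem_image.1 hb
          exact Or.inr ⟨a, ha, (hadj' a (hsub ha) x hxR').2 (hfx ▸ hby)⟩

lemma BallIso.rho_eq {G : SimpleGraph V} {H : SimpleGraph W}
    (hG : ∀ v, (G.neighborSet v).Finite) (hH : ∀ v, (H.neighborSet v).Finite)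
    {v : V} {w : W} {R : ℕ} (h : BallIso G H v w R) (p : ℝ) {s : ℕ} (hs : s ≤ R) (M : ℕ) :
    rho G p s M v = rho H p s M w := by
  obtain ⟨f, rfl, hinj, hadj, him⟩ := h.image_bl hG hH
  have hsub : bl G v s ⊆ bl G v R := bl_mono G v hs
  rw [rho, rho, ← him s hs, ← eg_image fun a ha b hb => hadj a (hsub ha) b (hsub hb)]
  exact (Ex_card_clu_image p (hinj.mono (coe_subset.2 hsub)) (eg_subset_sym2 _ _)
    (self_mem_bl G v s) fun n => if M ≤ n then 1 else 0).symm

lemma inBall_map {G : SimpleGraph V} {H : SimpleGraph W} (φ : G ≃g H) {u x : V} {n : ℕ}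
    (h : inBall G u n x) : inBall H (φ u) n (φ x) := by
  obtain ⟨w, hw⟩ := h
  exact ⟨w.map φ.toHom, by simpa using hw⟩

lemma IsTransitive.ballIso {G : SimpleGraph V} (h : IsTransitive G) (u v : V) (R : ℕ) :
    BallIso G G u v R := by
  obtain ⟨φ, rfl⟩ := h u v
  refine ⟨φ.toEquiv.subtypeEquiv fun a => ⟨inBall_map φ, fun h => ?_⟩, rfl, fun a b => ?_⟩
  · simpa using inBall_map φ.symm h
  · exact (φ.map_adj_iff).symm

lemma IsTransitive.rho_eq {G : SimpleGraph V} (h : IsTransitive G)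
    (hG : ∀ v, (G.neighborSet v).Finite) (p : ℝ) (s M : ℕ) (u v : V) :
    rho G p s M u = rho G p s M v :=
  (h.ballIso u v s).rho_eq hG hG p le_rfl M

lemma BallIso.card_neighbors {G : SimpleGraph V} {H : SimpleGraph W}
    (hG : ∀ v, (G.neighborSet v).Finite) (hH : ∀ v, (H.neighborSet v).Finite)
    {v : V} {w : W} {R : ℕ} (hR : 1 ≤ R) (h : BallIso G H v w R) :
    (bl G v 1).card = (bl H w 1).card := by
  obtain ⟨f, rfl, hinj, hadj, him⟩ := h.image_bl hG hH
  rw [← him 1 hR, card_image_of_injOn (hinj.mono (coe_subset.2 (bl_mono G v hR)))]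

end

section
open scoped Classical
open Finset

variable {V : Type*}

lemma Ex_one {α : Type*} (E : Finset α) (f : Finset α → ℝ) : Ex 1 E f = f E := by
  induction E using Finset.induction_on generalizing f with
  | empty => exact Ex_empty _ _
  | insert e E he ih => rw [Ex_insert 1 he, ih, ih]; ring

lemma connectedVia_of_reach {G : SimpleGraph V} {S : Finset (Sym2 V)}
    (hS : ∀ e ∈ S, e ∈ G.edgeSet) {x y : V} (h : reach S x y) : connectedVia G S x y := by
  induction h with
  | refl => exact ⟨SimpleGraph.Walk.nil, by simp⟩
  | tail _ h ih =>
    obtain ⟨w, hw⟩ := ih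
    have hadj : G.Adj _ _ := hS _ h
    refine ⟨w.concat hadj, fun e he => ?_⟩
    rw [SimpleGraph.Walk.edges_concat, List.concat_eq_append, List.mem_append] at he
    rcases he with he | he
    · exact hw e he
    · rw [List.mem_singleton.1 he]; exact h

lemma connectedVia.reach {G : SimpleGraph V} {S : Finset (Sym2 V)} {x y : V}
    (h : connectedVia G S x y) : reach (S.filter (· ∈ G.edgeSet)) x y := by
  obtain ⟨w, hw⟩ := h
  induction w with
  | nil => exact reach.refl _ _
  | cons hadj w ih =>
    refine Relation.ReflTransGen.head ?_ (ih fun e he => hw e (by simp [he]))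
    exact mem_filter.2 ⟨hw _ (by simp), hadj⟩

/-- A path leaving the ball of radius `s` visits every sphere of smaller radius. -/
lemma card_clu_of_exit {G : SimpleGraph V} (hG : ∀ v, (G.neighborSet v).Finite)
    {S : Finset (Sym2 V)} (hS : ∀ e ∈ S, e ∈ G.edgeSet) {v x : V} {s : ℕ} (h : reach S v x)
    (hx : x ∉ bl G v s) : s + 1 ≤ (clu (S ∩ eg G (bl G v s)) {v}).card := by
  set C := clu (S ∩ eg G (bl G v s)) {v} with hC
  have key : ∀ j < s, ∃ y ∈ C, y ∈ bl G v (j + 1) ∧ y ∉ bl G v j := by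
    intro j hj
    by_contra! hcon
    have : ∀ y, reach S v y → y ∈ C ∧ y ∈ bl G v j := by
      intro y hy
      induction hy with
      | refl => exact ⟨subset_clu _ _ (by simp), self_mem_bl G v j⟩
      | @tail y z _ hyz ih =>
        have hz : z ∈ bl G v (j + 1) := by
          rw [bl_succ, mem_nb hG]
          exact Or.inr ⟨y, ih.2, hS _ hyz⟩
        have hzC : z ∈ C := by
          rw [hC, mem_clu_singleton] at ih ⊢
          refine ih.1.tail (mem_inter.2 ⟨hyz, mem_eg.2 ⟨bl_mono G v hj.le ih.2,
            bl_mono G v hj hz, hS _ hyz⟩⟩)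
        exact ⟨hzC, hcon z hzC hz⟩
    exact hx (bl_mono G v hj.le (this x h).2)
  have : ∀ j ≤ s, j + 1 ≤ (C ∩ bl G v j).card := by
    intro j hj
    induction j with
    | zero =>
      exact Finset.card_pos.2 ⟨v, mem_inter.2 ⟨subset_clu _ _ (by simp), self_mem_bl G v 0⟩⟩
    | succ j ih =>
      obtain ⟨y, hyC, hy, hy'⟩ := key j hj
      refine Nat.succ_le_of_lt (lt_of_le_of_lt (ih (by omega)) (card_lt_card ?_))
      rw [Finset.ssubset_iff_of_subset (inter_subset_inter_left (bl_mono G v (Nat.le_succ j)))]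
      exact ⟨y, mem_inter.2 ⟨hyC, hy⟩, fun h => hy' (mem_inter.1 h).2⟩
  exact (this s le_rfl).trans (card_le_card inter_subset_left)

lemma cylProb_eq (p : ℝ) (E : Finset (Sym2 V)) (A : Finset (Sym2 V) → Prop) :
    cylProb p E A = Ex p E fun S => if A S then 1 else 0 := by
  unfold cylProb Ex
  exact sum_congr rfl fun S _ => by by_cases h : A S <;> simp [h]

lemma cylProb_nonneg {p : ℝ} (h0 : 0 ≤ p) (h1 : p ≤ 1) (E : Finset (Sym2 V))
    (A : Finset (Sym2 V) → Prop) : 0 ≤ cylProb p E A := by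
  rw [cylProb_eq]
  exact Ex_nonneg h0 h1 fun S _ => by split_ifs <;> norm_num

lemma cylProb_bddAbove {p : ℝ} (h0 : 0 ≤ p) (h1 : p ≤ 1) (A : Finset (Sym2 V) → Prop) :
    BddAbove (Set.range fun E => cylProb p E A) := by
  refine ⟨1, ?_⟩
  rintro _ ⟨E, rfl⟩
  dsimp only
  rw [cylProb_eq]
  exact (Ex_mono h0 h1 fun S _ => by split_ifs <;> norm_num).trans_eq (Ex_const p E 1)

lemma prob_nonneg {p : ℝ} (h0 : 0 ≤ p) (h1 : p ≤ 1) (A : Finset (Sym2 V) → Prop) :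
    0 ≤ prob p A :=
  (cylProb_nonneg h0 h1 ∅ A).trans (le_ciSup (cylProb_bddAbove h0 h1 A) ∅)

lemma theta_le_rho {G : SimpleGraph V} (hG : ∀ v, (G.neighborSet v).Finite) {p : ℝ}
    (h0 : 0 ≤ p) (h1 : p ≤ 1) (v : V) (s : ℕ) : theta G p v ≤ rho G p s s v := by
  have hb : BddBelow (Set.range fun n : ℕ =>
      prob p (fun S => ∃ x : V, ¬ inBall G v n x ∧ connectedVia G S v x)) :=
    ⟨0, by rintro _ ⟨n, rfl⟩; exact prob_nonneg h0 h1 _⟩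
  refine (ciInf_le hb s).trans (ciSup_le fun E => ?_)
  rw [cylProb_eq, rho]
  have hle : Ex p E (fun S => if ∃ x : V, ¬ inBall G v s x ∧ connectedVia G S v x then 1 else 0) ≤
      Ex p E (fun S => if s ≤ (clu (S ∩ (eg G (bl G v s) ∩ E)) {v}).card then 1 else 0) := by
    refine Ex_mono h0 h1 fun S hS => ?_
    by_cases hA : ∃ x : V, ¬ inBall G v s x ∧ connectedVia G S v x
    · obtain ⟨x, hx, hc⟩ := hA
      have h2 := card_clu_of_exit (S := S.filter (· ∈ G.edgeSet)) hG
        (fun e he => (mem_filter.1 he).2) hc.reach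
        (fun h => hx ((mem_bl hG).1 h))
      have h3 := card_le_card (clu_mono (S := S.filter (· ∈ G.edgeSet) ∩ eg G (bl G v s))
        (T := S ∩ (eg G (bl G v s) ∩ E)) (fun e he => by
          simp only [mem_inter, mem_filter] at he ⊢
          exact ⟨he.1.1, he.2, hS he.1.1⟩) {v})
      rw [if_pos (by omega : s ≤ _)]
      split_ifs <;> norm_num
    · rw [if_neg hA]
      split_ifs <;> norm_num
  refine hle.trans ?_
  rw [Ex_restrict p inter_subset_right (fun S => if s ≤ (clu S {v}).card then (1 : ℝ) else 0)]
  exact Ex_mono_set h0 h1 inter_subset_left (monotone_ind_card_clu s {v})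

lemma le_theta_of_le_rho {G : SimpleGraph V} {p : ℝ} (hG : ∀ v, (G.neighborSet v).Finite)
    (h0 : 0 ≤ p) (h1 : p ≤ 1) {v : V} {c : ℝ} (h : ∀ M, ∃ s, c ≤ rho G p s M v) :
    c ≤ theta G p v := by
  refine le_ciInf fun n => ?_
  obtain ⟨s, hs⟩ := h ((bl G v n).card + 1)
  refine hs.trans (le_trans ?_ (le_ciSup (cylProb_bddAbove h0 h1 _) (eg G (bl G v s))))
  rw [cylProb_eq, rho]
  refine Ex_mono h0 h1 fun S hS => ?_
  by_cases hc : (bl G v n).card + 1 ≤ (clu S {v}).card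
  · obtain ⟨x, hx, hx'⟩ := exists_mem_notMem_of_card_lt_card (Nat.lt_of_succ_le hc)
    rw [if_pos hc, if_pos]
    refine ⟨x, fun h => hx' ((mem_bl hG).2 h), connectedVia_of_reach (fun e he => ?_)
      (mem_clu_singleton.1 hx)⟩
    exact (mem_filter.1 (hS he)).2
  · rw [if_neg hc]
    split_ifs <;> norm_num

lemma theta_le_theta {G : SimpleGraph V} (hG : ∀ v, (G.neighborSet v).Finite)
    (ht : IsTransitive G) {p q : ℝ} (h0 : 0 ≤ p) (hpq : p ≤ q) (h1 : q ≤ 1) (u v : V) :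
    theta G p u ≤ theta G q v :=
  le_theta_of_le_rho hG (h0.trans hpq) h1 fun M => ⟨M, by
    rw [← ht.rho_eq hG q M M u v]
    exact (theta_le_rho hG h0 (hpq.trans h1) u M).trans (rho_mono_p G h0 hpq h1 M M u)⟩

lemma theta_one_pos {G : SimpleGraph V} (hG : ∀ v, (G.neighborSet v).Finite)
    (hc : G.Connected) (hinf : Infinite V) (v : V) : 0 < theta G 1 v := by
  refine lt_of_lt_of_le one_pos (le_theta_of_le_rho hG zero_le_one le_rfl fun M => ⟨M, ?_⟩)
  obtain ⟨x, hx⟩ := Infinite.exists_notMem_finset (bl G v M)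
  obtain ⟨w⟩ := hc.preconnected v x
  have hcv : connectedVia G w.edges.toFinset v x := ⟨w, fun e he => by simpa using he⟩
  have h2 := card_clu_of_exit (S := w.edges.toFinset.filter (· ∈ G.edgeSet)) hG
    (fun e he => (mem_filter.1 he).2) hcv.reach hx
  have h3 := card_le_card (clu_mono (inter_subset_right (s₁ := w.edges.toFinset.filter
    (· ∈ G.edgeSet)) (s₂ := eg G (bl G v M))) {v})
  rw [rho, Ex_one, if_pos (by omega)]

lemma pc_nonneg (G : SimpleGraph V) : 0 ≤ pc G := Real.sInf_nonneg fun _ h => h.1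

lemma pc_le_of_theta_pos {G : SimpleGraph V} {p : ℝ} (h0 : 0 ≤ p) (h1 : p ≤ 1) {v : V}
    (h : 0 < theta G p v) : pc G ≤ p := csInf_le ⟨0, fun _ h => h.1⟩ ⟨h0, h1, v, h⟩

lemma pc_le_one {G : SimpleGraph V} (hG : ∀ v, (G.neighborSet v).Finite)
    (hc : G.Connected) (hinf : Infinite V) : pc G ≤ 1 :=
  pc_le_of_theta_pos zero_le_one le_rfl (theta_one_pos hG hc hinf hc.nonempty.some)

lemma theta_pos_of_pc_lt {G : SimpleGraph V} (hG : ∀ v, (G.neighborSet v).Finite)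
    (hc : G.Connected) (hinf : Infinite V) (ht : IsTransitive G) {p : ℝ} (hp : pc G < p)
    (h1 : p ≤ 1) (v : V) : 0 < theta G p v := by
  have hne : {p : ℝ | 0 ≤ p ∧ p ≤ 1 ∧ ∃ v : V, 0 < theta G p v}.Nonempty :=
    ⟨1, zero_le_one, le_rfl, hc.nonempty.some, theta_one_pos hG hc hinf _⟩
  obtain ⟨q, ⟨hq0, -, u, hu⟩, hqp⟩ := exists_lt_of_csInf_lt hne hp
  exact hu.trans_le (theta_le_theta hG ht hq0 hqp.le h1 u v)

end

section
open scoped Classical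
open Finset

variable {V : Type*}

lemma Ex_ind_mul {α : Type*} [DecidableEq α] (p : ℝ) {E D : Finset α} {e : α} (he : e ∈ E) (hD : D ⊆ E)
    (heD : e ∉ D) (g : Finset α → ℝ) :
    Ex p E (fun S => if e ∈ S then g (S ∩ D) else 0) = p * Ex p D g := by
  rw [← insert_erase he, Ex_insert p (notMem_erase e E)]
  have h1 : Ex p (E.erase e) (fun S => if e ∈ S then g (S ∩ D) else 0) = 0 := by
    refine Eq.trans (Ex_congr fun S hS => ?_) (Ex_const p (E.erase e) 0)
    exact if_neg fun h => notMem_erase e E (hS h)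
  have h2 : ∀ S, insert e S ∩ D = S ∩ D := fun S => insert_inter_of_notMem heD
  simp only [h1, h2, mem_insert_self, if_true]
  rw [Ex_restrict p (subset_erase.2 ⟨hD, heD⟩) g]
  ring

/-- Decomposition of a path at its last visit to `A`. -/
lemma exists_last_exit {S : Finset (Sym2 V)} {A : Finset V} {v x : V} (h : reach S v x)
    (hv : v ∈ A) (hx : x ∉ A) :
    ∃ y ∈ A, ∃ w, w ∉ A ∧ s(y, w) ∈ S ∧ reach (del S A) w x := by
  induction h with
  | refl => exact absurd hv hx
  | @tail y z _ hs ih =>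
    by_cases hy : y ∈ A
    · exact ⟨y, hy, z, hx, hs, reach.refl _ _⟩
    · obtain ⟨y', hy', w, hw, hs', hr⟩ := ih hy
      refine ⟨y', hy', w, hw, hs', hr.tail (mem_del.2 ⟨hs, fun a ha hae => ?_⟩)⟩
      rcases Sym2.mem_iff.1 hae with rfl | rfl
      · exact hy ha
      · exact hx ha

/-- The oriented edges of `G` leading into `U`. -/
noncomputable def ob (G : SimpleGraph V) (U : Finset V) : Finset (V × V) :=
  (nb G U ×ˢ U).filter fun q => q.1 ∉ U ∧ G.Adj q.1 q.2

lemma mem_ob {G : SimpleGraph V} (hG : ∀ v, (G.neighborSet v).Finite) {U : Finset V}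
    {q : V × V} : q ∈ ob G U ↔ q.1 ∉ U ∧ q.2 ∈ U ∧ G.Adj q.1 q.2 := by
  simp only [ob, mem_filter, mem_product, mem_nb hG]
  constructor
  · tauto
  · rintro ⟨h1, h2, h3⟩
    exact ⟨⟨Or.inr ⟨_, h2, h3.symm⟩, h2⟩, h1, h3⟩

/-- The expected number of boundary edges of `U` joined to `v` inside `U`. -/
noncomputable def psi (G : SimpleGraph V) (p : ℝ) (U : Finset V) (v : V) : ℝ :=
  ∑ q ∈ ob G U, Ex p (eg G U) fun S => if v ∈ clu S {q.2} then 1 else 0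

lemma mem_clu_singleton_comm {S : Finset (Sym2 V)} {x y : V} :
    x ∈ clu S {y} ↔ y ∈ clu S {x} := by
  rw [mem_clu_singleton, mem_clu_singleton]
  exact ⟨reach.symm, reach.symm⟩

lemma card_clu_union_le {G : SimpleGraph V} (hG : ∀ v, (G.neighborSet v).Finite)
    {E S₁ S₂ : Finset (Sym2 V)} (hE : ∀ e ∈ E, e ∈ G.edgeSet) {U : Finset V} {v : V}
    (hv : v ∈ U) (hS₁ : S₁ ⊆ E.filter (· ∈ U.sym2)) (hS₂ : S₂ ⊆ E.filter (· ∉ U.sym2)) :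
    ((clu (S₁ ∪ S₂) {v}).card : ℝ) ≤ U.card + ∑ q ∈ ob G U,
      if q.2 ∈ clu S₁ {v} then (if s(q.1, q.2) ∈ S₂ then
        ((clu (S₁ ∩ del (E.filter (· ∈ U.sym2)) (clu S₁ {v}) ∪
          S₂ ∩ del (E.filter (· ∉ U.sym2)) (clu S₁ {v})) {q.1}).card : ℝ) else 0) else 0 := by
  set A := clu S₁ {v} with hA
  have hAU : A ⊆ U := clu_subset (fun e he => (mem_filter.1 (hS₁ he)).2) (by simpa using hv)
  set T := S₁ ∩ del (E.filter (· ∈ U.sym2)) A ∪ S₂ ∩ del (E.filter (· ∉ U.sym2)) A with hT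
  have hTdel : del (S₁ ∪ S₂) A ⊆ T := by
    intro e he
    rw [mem_del] at he
    rcases mem_union.1 he.1 with h | h
    · exact mem_union_left _ (mem_inter.2 ⟨h, mem_del.2 ⟨hS₁ h, he.2⟩⟩)
    · exact mem_union_right _ (mem_inter.2 ⟨h, mem_del.2 ⟨hS₂ h, he.2⟩⟩)
  have hsub : clu (S₁ ∪ S₂) {v} ⊆ A ∪ ((ob G U).filter fun q => q.2 ∈ A ∧ s(q.1, q.2) ∈ S₂).biUnion
      fun q => clu T {q.1} := by
    intro x hx
    by_cases hxA : x ∈ A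
    · exact mem_union_left _ hxA
    · obtain ⟨y, hy, w, hw, hs, hr⟩ := exists_last_exit (mem_clu_singleton.1 hx)
        (subset_clu S₁ {v} (by simp)) hxA
      refine mem_union_right _ (mem_biUnion.2 ⟨(w, y), mem_filter.2 ⟨?_, hy, ?_⟩,
        mem_clu_singleton.2 (hr.mono hTdel)⟩)
      · have hs1 : s(y, w) ∉ S₁ := fun h => hw (by
          rw [mem_clu_singleton] at hy ⊢
          exact hy.tail h)
        have hs2 := mem_filter.1 (hS₂ ((mem_union.1 hs).resolve_left hs1))
        rw [mem_ob hG]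
        refine ⟨fun hwU => hs2.2 (mk_mem_sym2_iff.2 ⟨hAU hy, hwU⟩), hAU hy, ?_⟩
        exact (hE _ hs2.1 : G.Adj y w).symm
      · have hs1 : s(y, w) ∉ S₁ := fun h => hw (by
          rw [mem_clu_singleton] at hy ⊢
          exact hy.tail h)
        rw [Sym2.eq_swap]
        exact (mem_union.1 hs).resolve_left hs1
  have hcard : ((clu (S₁ ∪ S₂) {v}).card : ℝ) ≤ A.card +
      ∑ q ∈ (ob G U).filter fun q => q.2 ∈ A ∧ s(q.1, q.2) ∈ S₂, ((clu T {q.1}).card : ℝ) := by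
    have := (card_le_card hsub).trans ((card_union_le _ _).trans
      (Nat.add_le_add_left card_biUnion_le _))
    exact_mod_cast this
  refine hcard.trans (add_le_add (by exact_mod_cast card_le_card hAU) (le_of_eq ?_))
  rw [sum_filter]
  refine sum_congr rfl fun q _ => ?_
  split_ifs <;> first | rfl | tauto

lemma Ex_card_clu_le {G : SimpleGraph V} (hG : ∀ v, (G.neighborSet v).Finite)
    (ht : IsTransitive G) {p : ℝ} (h0 : 0 ≤ p) (h1 : p ≤ 1) {U : Finset V} {v : V}
    (hv : v ∈ U) {K : ℝ} (hK0 : 0 ≤ K) (hK : U.card + p * psi G p U v * K ≤ K)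
    (E : Finset (Sym2 V)) (hE : ∀ e ∈ E, e ∈ G.edgeSet) (u : V) :
    Ex p E (fun S => ((clu S {u}).card : ℝ)) ≤ K := by
  induction hn : E.card using Nat.strong_induction_on generalizing E u with
  | _ n ih =>
  subst hn
  wlog huv : u = v generalizing E u
  · obtain ⟨φ, hφ⟩ := ht u v
    have hcard : (E.image (Sym2.map φ)).card ≤ E.card := card_image_le
    have := this (E.image (Sym2.map φ)) (fun e he => by
      obtain ⟨e', he', rfl⟩ := mem_image.1 he
      have := hE e' he'
      induction e' using Sym2.ind with
      | _ a b => exact (φ.map_adj_iff).2 this) (φ u)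
      (fun m hm E' hE' u' hE'm => ih m (hm.trans_le hcard) E' hE' u' hE'm) hφ
    rwa [Ex_card_clu_image p (U := insert u (E.biUnion Sym2.toFinset)) φ.injective.injOn
      (fun e he => by
        rw [mem_sym2_iff]
        intro a ha
        exact mem_insert_of_mem (mem_biUnion.2 ⟨e, he, by simpa using ha⟩))
      (mem_insert_self _ _) (fun n => (n : ℝ))] at this
  subst huv
  set Ei := E.filter (· ∈ U.sym2) with hEi
  set Eo := E.filter (· ∉ U.sym2) with hEo
  have hdis : Disjoint Ei Eo := disjoint_filter_filter_not _ _ _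
  have hun : Ei ∪ Eo = E := filter_union_filter_not_eq _ _
  have hterm : ∀ q ∈ ob G U, Ex p Ei (fun S₁ => Ex p Eo (fun S₂ =>
      if q.2 ∈ clu S₁ {u} then (if s(q.1, q.2) ∈ S₂ then
        ((clu (S₁ ∩ del Ei (clu S₁ {u}) ∪ S₂ ∩ del Eo (clu S₁ {u})) {q.1}).card : ℝ)
          else 0) else 0)) ≤
      p * K * Ex p (eg G U) (fun S => if u ∈ clu S {q.2} then 1 else 0) := by
    intro q hq
    have hdec := Ex_decouple p Ei {u} (fun A T => Ex p Eo (fun S₂ =>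
      if q.2 ∈ A then (if s(q.1, q.2) ∈ S₂ then
        ((clu (T ∩ del Ei A ∪ S₂ ∩ del Eo A) {q.1}).card : ℝ) else 0) else 0))
    simp only [inter_assoc, inter_self] at hdec
    rw [hdec]
    have hle : ∀ S ⊆ Ei, Ex p (del Ei (clu S {u})) (fun T => Ex p Eo (fun S₂ =>
        if q.2 ∈ clu S {u} then (if s(q.1, q.2) ∈ S₂ then
        ((clu (T ∩ del Ei (clu S {u}) ∪ S₂ ∩ del Eo (clu S {u})) {q.1}).card : ℝ)
          else 0) else 0)) ≤ p * K * (if u ∈ clu S {q.2} then 1 else 0) := by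
      intro S hS
      simp only [mem_clu_singleton_comm (x := u)]
      by_cases hqA : q.2 ∈ clu S {u}
      · simp only [hqA, if_true, mul_one]
        set A := clu S {u} with hA
        by_cases he : s(q.1, q.2) ∈ Eo
        · have heD : ∀ D, s(q.1, q.2) ∉ del D A := fun D h =>
            (mem_del.1 h).2 q.2 hqA (Sym2.mem_mk_right _ _)
          have hdel : del Ei A ∪ del Eo A = del E A := by
            rw [← hun, del, del, del, filter_union]
          have hddis : Disjoint (del Ei A) (del Eo A) :=
            disjoint_of_subset_left (del_subset _ _) (disjoint_of_subset_right (del_subset _ _) hdis)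
          have h2 : Ex p (del Ei A) (fun T => Ex p Eo (fun S₂ => if s(q.1, q.2) ∈ S₂ then
              ((clu (T ∩ del Ei A ∪ S₂ ∩ del Eo A) {q.1}).card : ℝ) else 0)) =
              p * Ex p (del E A) (fun S => ((clu S {q.1}).card : ℝ)) := by
            rw [← hdel, Ex_union p hddis, ← Ex_const_mul]
            refine Ex_congr fun T hT => ?_
            rw [inter_eq_left.2 hT]
            exact Ex_ind_mul p he (del_subset _ _) (heD _) (fun S => ((clu (T ∪ S) {q.1}).card : ℝ))
          rw [h2]
          refine mul_le_mul_of_nonneg_left (ih _ (card_lt_card ?_) (del E A)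
            (fun e he => hE e (del_subset _ _ he)) q.1 rfl) h0
          rw [Finset.ssubset_iff_of_subset (del_subset _ _)]
          exact ⟨_, (mem_filter.1 he).1, heD E⟩
        · refine le_trans (le_of_eq ?_) (mul_nonneg h0 hK0)
          exact (Ex_congr fun T _ => (Ex_congr fun S₂ hS₂ => if_neg fun h => he (hS₂ h)).trans
            (Ex_const p Eo 0)).trans (Ex_const p (del Ei A) 0)
      · simp only [hqA, if_false, Ex_const, mul_zero, le_refl]
    refine (Ex_mono h0 h1 hle).trans ?_
    rw [Ex_const_mul]
    refine mul_le_mul_of_nonneg_left (Ex_mono_set h0 h1 (fun e he => ?_) ?_) (mul_nonneg h0 hK0)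
    · exact mem_filter.2 ⟨(mem_filter.1 he).2, hE e (mem_filter.1 he).1⟩
    · intro S T hST
      have := @clu_mono _ S T hST {q.2} u
      dsimp only
      split_ifs <;> first | (exfalso; tauto) | norm_num
  calc Ex p E (fun S => ((clu S {u}).card : ℝ))
      = Ex p Ei (fun S₁ => Ex p Eo (fun S₂ => ((clu (S₁ ∪ S₂) {u}).card : ℝ))) := by
        conv_lhs => rw [← hun]
        exact Ex_union p hdis _
    _ ≤ Ex p Ei (fun S₁ => Ex p Eo (fun S₂ => U.card + ∑ q ∈ ob G U,
          if q.2 ∈ clu S₁ {u} then (if s(q.1, q.2) ∈ S₂ then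
            ((clu (S₁ ∩ del Ei (clu S₁ {u}) ∪ S₂ ∩ del Eo (clu S₁ {u})) {q.1}).card : ℝ)
              else 0) else 0)) :=
        Ex_mono h0 h1 fun S₁ hS₁ => Ex_mono h0 h1 fun S₂ hS₂ =>
          card_clu_union_le hG hE hv hS₁ hS₂
    _ ≤ U.card + ∑ q ∈ ob G U,
          p * K * Ex p (eg G U) (fun S => if u ∈ clu S {q.2} then 1 else 0) := by
        simp only [Ex_add, Ex_const, Ex_sum]
        exact add_le_add le_rfl (sum_le_sum hterm)
    _ ≤ K := by
        rw [← mul_sum]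
        refine le_trans (le_of_eq ?_) hK
        rw [psi]; ring

/-- If there is percolation then the expected number of connections to the boundary of every
finite set is at least one. -/
lemma one_le_psi {G : SimpleGraph V} (hG : ∀ v, (G.neighborSet v).Finite)
    (ht : IsTransitive G) {p : ℝ} (h0 : 0 ≤ p) (h1 : p ≤ 1) {U : Finset V} {v : V}
    (hv : v ∈ U) (hθ : 0 < theta G p v) : 1 ≤ psi G p U v := by
  by_contra! hlt
  have hψ0 : 0 ≤ psi G p U v := sum_nonneg fun q _ => Ex_nonneg h0 h1 fun S _ => by
    split_ifs <;> norm_num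
  have hφ : p * psi G p U v < 1 := by nlinarith
  set φ := p * psi G p U v with hφd
  have hpos : 0 < 1 - φ := by linarith
  have hK : ∀ s : ℕ, s * theta G p v ≤ U.card / (1 - φ) := by
    intro s
    have h2 := Ex_card_clu_le hG ht h0 h1 hv (K := U.card / (1 - φ)) (by positivity) (by
      rw [← hφd]; apply le_of_eq; field_simp; ring) (eg G (bl G v s))
      (fun e he => (mem_filter.1 he).2) v
    refine le_trans (mul_le_mul_of_nonneg_left (theta_le_rho hG h0 h1 v s) (Nat.cast_nonneg s))
      (le_trans ?_ h2)
    rw [rho, ← Ex_const_mul]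
    refine Ex_mono h0 h1 fun S _ => ?_
    split_ifs with h
    · simpa using h
    · simp
  obtain ⟨n, hn⟩ := exists_nat_gt (U.card / (1 - φ) / theta G p v)
  rw [div_lt_iff₀ hθ] at hn
  linarith [hK n]

end

section
open scoped Classical
open Finset

variable {V : Type*}

lemma Ex_sub_ge_of_deriv_ge {α : Type*} [DecidableEq α] {a b c : ℝ} (hab : a ≤ b) (E : Finset α)
    (f : Finset α → ℝ)
    (h : ∀ p ∈ Set.Ioo a b, c ≤ ∑ e ∈ E, Ex p (E.erase e) (fun S => f (insert e S) - f S)) :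
    c * (b - a) ≤ Ex b E f - Ex a E f := by
  refine (convex_Icc a b).mul_sub_le_image_sub_of_le_deriv (f := fun p => Ex p E f)
    (fun p _ => (Ex_hasDerivAt p E f).continuousAt.continuousWithinAt)
    (fun p _ => (Ex_hasDerivAt p E f).differentiableAt.differentiableWithinAt)
    (fun p hp => ?_) a (Set.left_mem_Icc.2 hab) b (Set.right_mem_Icc.2 hab) hab
  rw [(Ex_hasDerivAt p E f).deriv]
  exact h p (by rwa [interior_Icc] at hp)

lemma theta_pos_mono {G : SimpleGraph V} (hG : ∀ v, (G.neighborSet v).Finite)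
    (ht : IsTransitive G) {p q : ℝ} (h0 : 0 ≤ p) (hpq : p ≤ q) (h1 : q ≤ 1) {u : V}
    (h : 0 < theta G p u) (v : V) : 0 < theta G q v :=
  h.trans_le (theta_le_theta hG ht h0 hpq h1 u v)

lemma del_eg (G : SimpleGraph V) (A C : Finset V) : del (eg G A) C = eg G (A \ C) := by
  ext e
  induction e using Sym2.ind with
  | _ x y =>
    simp only [mem_del, mem_eg, Finset.mem_sdiff, Sym2.mem_iff]
    constructor
    · rintro ⟨⟨hx, hy, h⟩, h'⟩
      exact ⟨⟨hx, fun hc => h' x hc (Or.inl rfl)⟩, ⟨hy, fun hc => h' y hc (Or.inr rfl)⟩, h⟩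
    · rintro ⟨⟨hx, hx'⟩, ⟨hy, hy'⟩, h⟩
      refine ⟨⟨hx, hy, h⟩, ?_⟩
      rintro a ha (rfl | rfl)
      · exact hx' ha
      · exact hy' ha

/-- Quantitative sharpness: strictly above a percolating parameter, large clusters have
probability bounded below by the increment of the parameter. -/
lemma half_sub_le_rho {G : SimpleGraph V} (hG : ∀ v, (G.neighborSet v).Finite)
    (ht : IsTransitive G) {a b : ℝ} (h0 : 0 ≤ a) (hab : a ≤ b) (h1 : b ≤ 1) {v : V}
    (hθ : 0 < theta G a v) (R : ℕ) : (b - a) / 2 ≤ rho G b (R + 1) (R + 1) v := by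
  set E := eg G (bl G v (R + 1)) with hE
  set B := bl G v (R + 1) \ bl G v R with hB
  set F : Finset V → ℝ := fun C => if v ∈ C then 1 else 0 with hF
  have hFmono : Monotone F := by
    intro C C' h
    have := @h v
    simp only [hF]
    split_ifs <;> first | (exfalso; tauto) | norm_num
  have hfmono : Monotone fun S : Finset (Sym2 V) => F (clu S B) :=
    fun S T h => hFmono (clu_mono h B)
  have hrho : Ex b E (fun S => F (clu S B)) ≤ rho G b (R + 1) (R + 1) v := by
    refine Ex_mono (h0.trans hab) h1 fun S hS => ?_
    simp only [hF]
    by_cases hv : v ∈ clu S B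
    · obtain ⟨x, hx, hr⟩ := mem_clu.1 hv
      have h2 := card_clu_of_exit hG (fun e he => (mem_filter.1 (hS he)).2) hr.symm
        (Finset.mem_sdiff.1 hx).2
      have h3 := card_le_card (clu_mono (inter_subset_left (s₁ := S) (s₂ := eg G (bl G v R))) {v})
      rw [if_pos hv, if_pos (by omega)]
    · rw [if_neg hv]
      split_ifs <;> norm_num
  have hderiv : ∀ p ∈ Set.Ioo a b, 1 - Ex b E (fun S => F (clu S B)) ≤
      ∑ e ∈ E, Ex p (E.erase e) (fun S => F (clu (insert e S) B) - F (clu S B)) := by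
    intro p hp
    have hp0 : 0 ≤ p := h0.trans hp.1.le
    have hp1 : p ≤ 1 := hp.2.le.trans h1
    refine le_trans ?_ (deriv_Ex_clu_ge hp0 hp1 E B hFmono)
    refine le_trans (sub_le_sub_left (Ex_mono_p hp0 hp.2.le h1 E hfmono) 1) ?_
    rw [← Ex_const p E 1, ← Ex_sub]
    refine Ex_mono hp0 hp1 fun S hS => ?_
    set C := clu S B with hC
    have hCpos : ∀ q ∈ bd E C, ∀ S', 0 ≤ F (C ∪ clu S' {q.2}) - F C := fun q _ S' =>
      sub_nonneg.2 (hFmono subset_union_left)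
    by_cases hv : v ∈ C
    · rw [show F C = 1 from if_pos hv, sub_self]
      exact sum_nonneg fun q hq => Ex_nonneg hp0 hp1 fun S' _ => by
        have := hCpos q hq S'
        rwa [show F C = 1 from if_pos hv] at this
    · have hFC : F C = 0 := if_neg hv
      rw [hFC, sub_zero]
      set U := bl G v (R + 1) \ C with hU
      have hvU : v ∈ U := Finset.mem_sdiff.2 ⟨self_mem_bl G v _, hv⟩
      refine (one_le_psi hG ht hp0 hp1 hvU
        (theta_pos_mono hG ht h0 hp.1.le hp1 hθ v)).trans ?_
      have hob : ob G U ⊆ bd E C := by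
        intro q hq
        rw [mem_ob hG] at hq
        have hq2 := Finset.mem_sdiff.1 hq.2.1
        have hq2' : q.2 ∈ bl G v R := by
          by_contra h
          exact hq2.2 (subset_clu S B (Finset.mem_sdiff.2 ⟨hq2.1, h⟩))
        have hq1 : q.1 ∈ bl G v (R + 1) := by
          rw [bl_succ, mem_nb hG]
          exact Or.inr ⟨q.2, hq2', hq.2.2.symm⟩
        have hq1C : q.1 ∈ C := by
          by_contra h
          exact hq.1 (Finset.mem_sdiff.2 ⟨hq1, h⟩)
        exact mem_bd.2 ⟨hq1C, hq2.2, mem_eg.2 ⟨hq1, hq2.1, hq.2.2⟩⟩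
      refine le_trans ?_ (sum_le_sum_of_subset_of_nonneg hob fun q hq _ =>
        Ex_nonneg hp0 hp1 fun S' _ => by
          have := hCpos q hq S'
          rwa [hFC] at this)
      rw [psi, hE, del_eg]
      refine sum_le_sum fun q _ => Ex_mono hp0 hp1 fun S' _ => ?_
      simp only [hF]
      split_ifs with h2 h3 <;> first | exact absurd (mem_union_right _ h2) h3 | norm_num
  have hm := Ex_sub_ge_of_deriv_ge hab E (fun S => F (clu S B)) hderiv
  have hpos : 0 ≤ Ex a E (fun S => F (clu S B)) := Ex_nonneg h0 (hab.trans h1) fun S _ => by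
    simp only [hF]; split_ifs <;> norm_num
  have hpos' : 0 ≤ Ex b E (fun S => F (clu S B)) := Ex_nonneg (h0.trans hab) h1 fun S _ => by
    simp only [hF]; split_ifs <;> norm_num
  have : b - a ≤ 1 := by linarith
  nlinarith

end

section
open scoped Classical
open Finset

variable {V : Type*}

lemma lambda1_mul_le {G : SimpleGraph V} (hG : ∀ v, (G.neighborSet v).Finite) {d : ℕ}
    (hd : ∀ v, (G.neighborSet v).ncard = d) (hna : 0 < lambda1 G) {A : Finset V}
    (hA : A.Nonempty) :
    0 < d ∧ lambda1 G * (d * A.card) ≤ ∑ x ∈ A, (((hG x).toFinset \ A).card : ℝ) := by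
  set f : V →₀ ℝ := Finsupp.indicator A fun _ _ => 1 with hf
  have hfx : ∀ x, f x = if x ∈ A then 1 else 0 := fun x => by
    rw [hf, Finsupp.indicator_apply]; split_ifs <;> rfl
  have hsupp : f.support = A := by
    ext x
    rw [Finsupp.mem_support_iff, hfx]
    split_ifs with h <;> simp [h]
  have hf0 : f ≠ 0 := by
    intro h
    rw [h, Finsupp.support_zero] at hsupp
    exact hA.ne_empty hsupp.symm
  have hbdd : BddBelow {r : ℝ | ∃ f : V →₀ ℝ, f ≠ 0 ∧
    r = (∑ x ∈ f.support,
          (((G.neighborSet x).ncard : ℝ) * f x - ∑' y : G.neighborSet x, f (y : V)) * f x) /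
        (∑ x ∈ f.support, ((G.neighborSet x).ncard : ℝ) * f x ^ 2)} := by
    by_contra h
    exact hna.ne' (Real.sInf_of_not_bddBelow h)
  have hle := csInf_le hbdd ⟨f, hf0, rfl⟩
  change lambda1 G ≤ _ at hle
  rw [hsupp] at hle
  have hden : ∑ x ∈ A, ((G.neighborSet x).ncard : ℝ) * f x ^ 2 = d * A.card := by
    rw [sum_congr rfl fun x hx => show ((G.neighborSet x).ncard : ℝ) * f x ^ 2 = d by
      rw [hd, hfx, if_pos hx]; ring]
    simp [mul_comm]
  have hnum : ∑ x ∈ A, (((G.neighborSet x).ncard : ℝ) * f x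
      - ∑' y : G.neighborSet x, f (y : V)) * f x = ∑ x ∈ A, (((hG x).toFinset \ A).card : ℝ) := by
    refine sum_congr rfl fun x hx => ?_
    have h1 : ∑' y : G.neighborSet x, f (y : V) = (((hG x).toFinset ∩ A).card : ℝ) := by
      have h2 : ∑' y : ((hG x).toFinset : Set V), f (y : V) = ∑ y ∈ (hG x).toFinset, f y :=
        Finset.tsum_subtype' _ _
      rw [(hG x).coe_toFinset] at h2
      rw [h2]
      simp only [hfx]
      rw [sum_ite_mem]
      simp
    have h3 : (G.neighborSet x).ncard = (hG x).toFinset.card := Set.ncard_eq_toFinset_card _ (hG x)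
    have h4 := card_sdiff_add_card_inter (hG x).toFinset A
    rw [h1, hfx, if_pos hx, h3, ← h4]
    push_cast
    ring
  rw [hden, hnum] at hle
  have hd0 : 0 < d := by
    rcases Nat.eq_zero_or_pos d with h | h
    · subst h
      simp only [Nat.cast_zero, zero_mul, div_zero] at hle
      exact absurd hle (not_le.2 hna)
    · exact h
  have : (0 : ℝ) < d * A.card := by
    have := hA.card_pos
    positivity
  exact ⟨hd0, (le_div_iff₀ this).1 hle⟩

lemma lambda1_le_one [Nonempty V] {G : SimpleGraph V} (hG : ∀ v, (G.neighborSet v).Finite) {d : ℕ}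
    (hd : ∀ v, (G.neighborSet v).ncard = d) (hna : 0 < lambda1 G) : lambda1 G ≤ 1 := by
  let v := Classical.arbitrary V
  obtain ⟨h0, h⟩ := lambda1_mul_le hG hd hna (singleton_nonempty v)
  have h3 : (G.neighborSet v).ncard = (hG v).toFinset.card := Set.ncard_eq_toFinset_card _ (hG v)
  have h4 : (((hG v).toFinset \ {v}).card : ℝ) ≤ d := by
    rw [← hd v, h3]
    exact_mod_cast card_le_card sdiff_subset
  simp only [card_singleton, Nat.cast_one, mul_one, sum_singleton] at h
  have : (0 : ℝ) < d := by exact_mod_cast h0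
  nlinarith

lemma card_nb_ge {G : SimpleGraph V} (hG : ∀ v, (G.neighborSet v).Finite) {d : ℕ}
    (hd : ∀ v, (G.neighborSet v).ncard = d) (hna : 0 < lambda1 G) (A : Finset V) :
    (1 + lambda1 G) * A.card ≤ (nb G A).card := by
  rcases A.eq_empty_or_nonempty with rfl | hA
  · simp
  obtain ⟨h0, h⟩ := lambda1_mul_le hG hd hna hA
  have hcount : ∑ x ∈ A, ((hG x).toFinset \ A).card ≤ d * (nb G A \ A).card := by
    have h1 : ∀ x ∈ A, ((hG x).toFinset \ A).card =
        ∑ y ∈ nb G A \ A, if G.Adj x y then 1 else 0 := by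
      intro x hx
      rw [sum_boole, Nat.cast_id]
      congr 1
      ext y
      simp only [Finset.mem_sdiff, Set.Finite.mem_toFinset, SimpleGraph.mem_neighborSet,
        mem_filter, mem_nb hG]
      constructor
      · rintro ⟨h1, h2⟩
        exact ⟨⟨Or.inr ⟨x, hx, h1⟩, h2⟩, h1⟩
      · rintro ⟨⟨-, h2⟩, h1⟩
        exact ⟨h1, h2⟩
    rw [sum_congr rfl h1, sum_comm, mul_comm, ← smul_eq_mul]
    refine sum_le_card_nsmul _ _ _ fun y _ => ?_
    rw [sum_boole, Nat.cast_id, ← hd y, Set.ncard_eq_toFinset_card _ (hG y)]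
    refine card_le_card fun x hx => ?_
    simpa using (mem_filter.1 hx).2.symm
  have h2 : ∑ x ∈ A, (((hG x).toFinset \ A).card : ℝ) ≤ d * (nb G A \ A).card := by
    exact_mod_cast hcount
  have h3 : (nb G A).card = (nb G A \ A).card + A.card :=
    (card_sdiff_add_card_eq_card (subset_nb G A)).symm
  have h4 : (0 : ℝ) < d := by exact_mod_cast h0
  have h5 : lambda1 G * A.card ≤ (nb G A \ A).card := by
    refine le_of_mul_le_mul_left (le_trans (le_of_eq ?_) (h.trans h2)) h4
    ring
  rw [h3]
  push_cast
  linarith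

lemma card_nb_iterate_ge {G : SimpleGraph V} (hG : ∀ v, (G.neighborSet v).Finite) {d : ℕ}
    (hd : ∀ v, (G.neighborSet v).ncard = d) (hna : 0 < lambda1 G) (A : Finset V) (t : ℕ) :
    (1 + lambda1 G) ^ t * A.card ≤ ((nb G)^[t] A).card := by
  induction t with
  | zero => simp
  | succ t ih =>
    rw [Function.iterate_succ_apply']
    refine le_trans ?_ (card_nb_ge hG hd hna _)
    rw [pow_succ', mul_assoc]
    exact mul_le_mul_of_nonneg_left ih (by linarith)

lemma card_nb_le {G : SimpleGraph V} (hG : ∀ v, (G.neighborSet v).Finite) {d : ℕ}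
    (hd : ∀ v, (G.neighborSet v).ncard = d) (A : Finset V) :
    (nb G A).card ≤ (d + 1) * A.card := by
  have h : (A.biUnion fun a => if h : (G.neighborSet a).Finite then h.toFinset else ∅).card
      ≤ A.card * d := by
    refine card_biUnion_le_card_mul _ _ _ fun a _ => ?_
    rw [dif_pos (hG a), ← Set.ncard_eq_toFinset_card _ (hG a), hd]
  have := card_union_le A (A.biUnion fun a =>
    if h : (G.neighborSet a).Finite then h.toFinset else ∅)
  rw [nb]
  linarith

lemma card_bl_le {G : SimpleGraph V} (hG : ∀ v, (G.neighborSet v).Finite) {d : ℕ}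
    (hd : ∀ v, (G.neighborSet v).ncard = d) (v : V) (t : ℕ) :
    (bl G v t).card ≤ (d + 1) ^ t := by
  induction t with
  | zero => simp [bl]
  | succ t ih =>
    rw [bl_succ, pow_succ']
    exact (card_nb_le hG hd _).trans (Nat.mul_le_mul_left _ ih)

lemma card_bl_one {G : SimpleGraph V} (hG : ∀ v, (G.neighborSet v).Finite) (v : V) :
    (bl G v 1).card = (G.neighborSet v).ncard + 1 := by
  have : bl G v 1 = insert v (hG v).toFinset := by
    ext x
    rw [bl_succ, mem_nb hG]
    simp [bl]
  rw [this, card_insert_of_notMem (by simp), Set.ncard_eq_toFinset_card _ (hG v)]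

end

section
open scoped Classical
open Finset

variable {V : Type*}

/-- The expected truncated cluster size. -/
noncomputable def tc (p : ℝ) (D : Finset (Sym2 V)) (M : ℕ) (x : V) : ℝ :=
  Ex p D fun S => min ((clu S {x}).card : ℝ) M

lemma tc_nonneg {p : ℝ} (h0 : 0 ≤ p) (h1 : p ≤ 1) (D : Finset (Sym2 V)) (M : ℕ) (x : V) :
    0 ≤ tc p D M x :=
  Ex_nonneg h0 h1 fun _ _ => le_min (Nat.cast_nonneg _) (Nat.cast_nonneg _)

lemma mul_tc_le_tc {p : ℝ} (h0 : 0 ≤ p) (h1 : p ≤ 1) {D : Finset (Sym2 V)} (M : ℕ) {x y : V}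
    (h : s(x, y) ∈ D) : p * tc p D M x ≤ tc p D M y := by
  refine le_trans (mul_le_mul_of_nonneg_left (Ex_mono h0 h1 fun S _ => ?_) h0)
    (Ex_insert_le h0 h1 h fun S => le_min (Nat.cast_nonneg _) (Nat.cast_nonneg _))
  refine min_le_min_right _ (Nat.cast_le.2 (card_le_card fun z hz => ?_))
  rw [mem_clu_singleton] at hz ⊢
  refine Relation.ReflTransGen.head ?_ (hz.mono (subset_insert _ _))
  rw [Sym2.eq_swap]
  exact mem_insert_self _ _

lemma exists_boundary_tc_ge {G : SimpleGraph V} (hG : ∀ v, (G.neighborSet v).Finite) {p : ℝ}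
    (h0 : 0 ≤ p) (h1 : p ≤ 1) {E : Finset (Sym2 V)} {A A' : Finset V} (hA : A' ⊆ A) (t : ℕ)
    (hE : eg G ((nb G)^[t] A') ⊆ E) (M : ℕ) {x : V} (hx : x ∈ (nb G)^[t] A') (hxA : x ∉ A) :
    ∃ q ∈ bd E A, inBall G q.2 t x ∧ p ^ t * tc p (del E A) M x ≤ tc p (del E A) M q.2 := by
  induction t generalizing x with
  | zero => exact absurd (hA hx) hxA
  | succ j ih =>
    rw [Function.iterate_succ_apply'] at hE hx
    have hE' : eg G ((nb G)^[j] A') ⊆ E := (eg_mono G (subset_nb G _)).trans hE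
    have hpow : p ^ (j + 1) ≤ p ^ j := pow_le_pow_of_le_one h0 h1 (Nat.le_succ j)
    rcases (mem_nb hG).1 hx with hx' | ⟨a, ha, hax⟩
    · obtain ⟨q, hq, hb, hle⟩ := ih hE' hx' hxA
      exact ⟨q, hq, inBall_succ.2 (Or.inl hb),
        (mul_le_mul_of_nonneg_right hpow (tc_nonneg h0 h1 _ _ _)).trans hle⟩
    · have hedge : s(a, x) ∈ E := hE (mem_eg.2 ⟨subset_nb _ _ ha, hx, hax⟩)
      by_cases haA : a ∈ A
      · refine ⟨(a, x), mem_bd.2 ⟨haA, hxA, hedge⟩, ⟨SimpleGraph.Walk.nil, by simp⟩, ?_⟩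
        exact mul_le_of_le_one_left (tc_nonneg h0 h1 _ _ _) (pow_le_one₀ h0 h1)
      · obtain ⟨q, hq, hb, hle⟩ := ih hE' ha haA
        refine ⟨q, hq, inBall_succ.2 (Or.inr ⟨a, hb, hax⟩), le_trans ?_ hle⟩
        rw [pow_succ, mul_assoc]
        refine mul_le_mul_of_nonneg_left (mul_tc_le_tc h0 h1 M ?_) (pow_nonneg h0 j)
        rw [Sym2.eq_swap]
        refine mem_del.2 ⟨hedge, fun b hbA hbe => ?_⟩
        rcases Sym2.mem_iff.1 hbe with rfl | rfl
        · exact haA hbA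
        · exact hxA hbA

lemma clu_eq_of_mem {S : Finset (Sym2 V)} {x y : V} (h : y ∈ clu S {x}) :
    clu S {y} = clu S {x} := by
  rw [mem_clu_singleton] at h
  ext z
  rw [mem_clu_singleton, mem_clu_singleton]
  exact ⟨h.trans, h.symm.trans⟩

/-- If deleting the edges at `A` changes the cluster of `x`, then `x` is joined to the outer
boundary of `A`. -/
lemma exists_boundary_mem_clu {E S : Finset (Sym2 V)} (hS : S ⊆ E) {A : Finset V} {x : V}
    (hx : x ∉ A) (h : ¬ clu S {x} ⊆ clu (S ∩ del E A) {x}) :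
    ∃ q ∈ bd E A, q.2 ∈ clu (S ∩ del E A) {x} := by
  by_contra! hcon
  refine h fun z hz => ?_
  rw [mem_clu_singleton] at hz
  have : z ∈ clu (S ∩ del E A) {x} ∧ z ∉ A := by
    induction hz with
    | refl => exact ⟨subset_clu _ _ (by simp), hx⟩
    | @tail y z _ hyz ih =>
      have hz : z ∉ A := fun hzA => hcon (z, y)
        (mem_bd.2 ⟨hzA, ih.2, by rw [Sym2.eq_swap]; exact hS hyz⟩) ih.1
      refine ⟨?_, hz⟩
      rw [mem_clu_singleton] at ih ⊢
      refine ih.1.tail (mem_inter.2 ⟨hyz, mem_del.2 ⟨hS hyz, fun b hb hbe => ?_⟩⟩)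
      rcases Sym2.mem_iff.1 hbe with rfl | rfl
      · exact ih.2 hb
      · exact hz hb
  exact this.1

lemma prob_big_le {p : ℝ} (h0 : 0 ≤ p) (h1 : p ≤ 1) (E : Finset (Sym2 V)) {A : Finset V} {x : V}
    (hx : x ∉ A) (M : ℕ) :
    M * Ex p E (fun S => if M ≤ (clu S {x}).card then 1 else 0) ≤ tc p (del E A) M x +
      M * Ex p (del E A) (fun S =>
        if (clu S {x}).card < M ∧ ∃ q ∈ bd E A, q.2 ∈ clu S {x} then 1 else 0) := by
  rw [tc, ← Ex_restrict p (del_subset E A), ← Ex_restrict p (del_subset E A)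
    (fun S => if (clu S {x}).card < M ∧ ∃ q ∈ bd E A, q.2 ∈ clu S {x} then (1 : ℝ) else 0),
    ← Ex_const_mul, ← Ex_const_mul, ← Ex_add]
  refine Ex_mono h0 h1 fun S hS => ?_
  have hM : (0 : ℝ) ≤ M := Nat.cast_nonneg M
  have hmin : (0 : ℝ) ≤ min ((clu (S ∩ del E A) {x}).card : ℝ) M := le_min (Nat.cast_nonneg _) hM
  by_cases hb : M ≤ (clu S {x}).card
  · rw [if_pos hb, mul_one]
    by_cases hb' : M ≤ (clu (S ∩ del E A) {x}).card
    · rw [min_eq_right (by exact_mod_cast hb')]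
      split_ifs <;> linarith
    · have hq := exists_boundary_mem_clu (E := E) hS hx fun h => hb' (hb.trans (card_le_card h))
      rw [if_pos ⟨not_le.1 hb', hq⟩]
      linarith
  · rw [if_neg hb]
    split_ifs <;> linarith

/-- The expected mass attached to `A` through its boundary edges is of the order of the size of
the `t`-neighbourhood of `A'`. -/
lemma gain_ge {G : SimpleGraph V} (hG : ∀ v, (G.neighborSet v).Finite) {d : ℕ}
    (hd : ∀ v, (G.neighborSet v).ncard = d) {p : ℝ} (h0 : 0 ≤ p) (h1 : p ≤ 1)
    {E : Finset (Sym2 V)} {A A' : Finset V} (hA : A' ⊆ A) (t : ℕ)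
    (hE : eg G ((nb G)^[t] A') ⊆ E) {M : ℕ} (hM : 0 < M) (hMt : ((d : ℝ) + 1) ^ t ≤ M * p ^ t)
    {q : ℝ} (hq : ∀ x ∈ (nb G)^[t] A', q ≤ Ex p E fun S => if M ≤ (clu S {x}).card then 1 else 0) :
    q / 2 * ((nb G)^[t] A' \ A).card ≤ ∑ z ∈ bd E A, tc p (del E A) M z.2 := by
  set X := (nb G)^[t] A' \ A with hX
  set gain := ∑ z ∈ bd E A, tc p (del E A) M z.2 with hgain
  have hM' : (0 : ℝ) < M := by exact_mod_cast hM
  have hpt : 0 < p ^ t := by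
    rcases (pow_nonneg h0 t).lt_or_eq with h | h
    · exact h
    · rw [← h, mul_zero] at hMt
      exact absurd hMt (not_le.2 (by positivity))
  have hX' : ∀ x ∈ X, x ∈ (nb G)^[t] A' ∧ x ∉ A := fun x hx => Finset.mem_sdiff.1 hx
  have hsum1 : ∑ x ∈ X, tc p (del E A) M x ≤ M * gain := by
    have h2 : ∀ x ∈ X, p ^ t * tc p (del E A) M x ≤
        ∑ z ∈ bd E A, if inBall G z.2 t x then tc p (del E A) M z.2 else 0 := by
      intro x hx
      obtain ⟨z, hz, hb, hle⟩ := exists_boundary_tc_ge hG h0 h1 hA t hE M (hX' x hx).1 (hX' x hx).2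
      refine hle.trans (le_trans (le_of_eq (if_pos hb).symm) (single_le_sum
        (f := fun z : V × V => if inBall G z.2 t x then tc p (del E A) M z.2 else 0)
        (fun w _ => ?_) hz))
      split_ifs
      · exact tc_nonneg h0 h1 _ _ _
      · exact le_rfl
    have h3 : p ^ t * ∑ x ∈ X, tc p (del E A) M x ≤ (d + 1) ^ t * gain := by
      rw [mul_sum]
      refine (sum_le_sum h2).trans ?_
      rw [sum_comm, hgain, mul_sum]
      refine sum_le_sum fun z _ => ?_
      rw [← sum_filter, sum_const, nsmul_eq_mul]
      refine mul_le_mul_of_nonneg_right ?_ (tc_nonneg h0 h1 _ _ _)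
      have : (X.filter fun x => inBall G z.2 t x).card ≤ (d + 1) ^ t :=
        (card_le_card fun x hx => (mem_bl hG).2 (mem_filter.1 hx).2).trans (card_bl_le hG hd z.2 t)
      exact_mod_cast this
    have hg0 : 0 ≤ gain := sum_nonneg fun z _ => tc_nonneg h0 h1 _ _ _
    have h4 := h3.trans (mul_le_mul_of_nonneg_right hMt hg0)
    refine le_of_mul_le_mul_left (h4.trans (le_of_eq ?_)) hpt
    ring
  have hsum2 : ∑ x ∈ X, Ex p (del E A) (fun S =>
      if (clu S {x}).card < M ∧ ∃ q ∈ bd E A, q.2 ∈ clu S {x} then (1 : ℝ) else 0) ≤ gain := by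
    rw [← Ex_sum, hgain]
    simp only [tc]
    rw [← Ex_sum]
    refine Ex_mono h0 h1 fun S _ => ?_
    rw [sum_boole]
    have hsub : (X.filter fun x => (clu S {x}).card < M ∧ ∃ q ∈ bd E A, q.2 ∈ clu S {x}) ⊆
        ((bd E A).filter fun z => (clu S {z.2}).card < M).biUnion fun z => clu S {z.2} := by
      intro x hx
      obtain ⟨-, hx1, z, hz, hzx⟩ := mem_filter.1 hx
      refine mem_biUnion.2 ⟨z, mem_filter.2 ⟨hz, ?_⟩, mem_clu_singleton_comm.1 hzx⟩
      rwa [clu_eq_of_mem hzx]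
    have hc := (card_le_card hsub).trans card_biUnion_le
    have hc' : ((X.filter fun x => (clu S {x}).card < M ∧ ∃ q ∈ bd E A, q.2 ∈ clu S {x}).card : ℝ) ≤
        ∑ z ∈ (bd E A).filter fun z => (clu S {z.2}).card < M, ((clu S {z.2}).card : ℝ) := by
      exact_mod_cast hc
    refine hc'.trans ?_
    rw [sum_filter]
    refine sum_le_sum fun z _ => ?_
    split_ifs with h
    · exact le_min le_rfl (by exact_mod_cast h.le)
    · exact le_min (Nat.cast_nonneg _) hM'.le
  have hsum3 : ∑ x ∈ X, M * q ≤ M * gain + M * gain := by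
    refine le_trans (sum_le_sum fun x hx => (mul_le_mul_of_nonneg_left (hq x (hX' x hx).1)
      hM'.le).trans (prob_big_le h0 h1 E (hX' x hx).2 M)) ?_
    rw [sum_add_distrib, ← mul_sum]
    exact add_le_add hsum1 (mul_le_mul_of_nonneg_left hsum2 hM'.le)
  rw [sum_const, nsmul_eq_mul] at hsum3
  have : M * (q / 2 * X.card) ≤ M * gain := by linarith
  exact le_of_mul_le_mul_left this hM'

end

section
open scoped Classical
open Finset

variable {V : Type*}

lemma sum_Ex_sub_ge_of_deriv_ge {α : Type*} [DecidableEq α] {a b c : ℝ} (hab : a ≤ b) (J : ℕ)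
    (E : ℕ → Finset α) (f : Finset α → ℝ)
    (h : ∀ p ∈ Set.Ioo a b, c ≤ ∑ j ∈ range J, ∑ e ∈ E j,
      Ex p ((E j).erase e) (fun S => f (insert e S) - f S)) :
    c * (b - a) ≤ ∑ j ∈ range J, (Ex b (E j) f - Ex a (E j) f) := by
  have hder : ∀ p, HasDerivAt (fun p => ∑ j ∈ range J, Ex p (E j) f) (∑ j ∈ range J, ∑ e ∈ E j,
      Ex p ((E j).erase e) (fun S => f (insert e S) - f S)) p := fun p =>
    HasDerivAt.fun_sum fun j _ => Ex_hasDerivAt p (E j) f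
  rw [sum_sub_distrib]
  refine (convex_Icc a b).mul_sub_le_image_sub_of_le_deriv (f := fun p => ∑ j ∈ range J, Ex p (E j) f)
    (fun p _ => (hder p).continuousAt.continuousWithinAt)
    (fun p _ => (hder p).differentiableAt.differentiableWithinAt)
    (fun p hp => ?_) a (Set.left_mem_Icc.2 hab) b (Set.right_mem_Icc.2 hab) hab
  rw [(hder p).deriv]
  exact h p (by rwa [interior_Icc] at hp)

lemma le_log_add_sub_log {a m : ℝ} (ha : 0 < a) (h0 : 0 ≤ m) (hm : m ≤ a) :
    m / (2 * a) ≤ Real.log (a + m) - Real.log a := by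
  rw [← Real.log_div (by linarith) ha.ne']
  have hpos : 0 < (a + m) / a := by positivity
  refine le_trans ?_ (Real.one_sub_inv_le_log_of_pos hpos)
  rw [inv_div, div_le_iff₀ (by positivity), one_sub_div (by linarith), div_mul_eq_mul_div,
    le_div_iff₀ (by linarith)]
  nlinarith

/-- The logarithm of the cardinality, truncated to the interval `[M₀, 2 * M]`. -/
noncomputable def lg (M₀ M : ℕ) (C : Finset V) : ℝ :=
  Real.log (min (max (C.card : ℝ) M₀) (2 * M))

lemma lg_monotone {M₀ M : ℕ} (h0 : 0 < M₀) (hM : M₀ ≤ M) : Monotone (lg (V := V) M₀ M) := by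
  intro A B h
  have h0' : (0 : ℝ) < M₀ := by exact_mod_cast h0
  have hM' : (M₀ : ℝ) ≤ M := by exact_mod_cast hM
  have : (A.card : ℝ) ≤ B.card := by exact_mod_cast card_le_card h
  refine Real.log_le_log (lt_min (lt_max_of_lt_right h0') (by linarith)) ?_
  exact min_le_min_right _ (max_le_max_right _ this)

lemma lg_nonneg {M₀ M : ℕ} (h0 : 0 < M₀) (hM : M₀ ≤ M) (C : Finset V) : 0 ≤ lg M₀ M C := by
  have h0' : (1 : ℝ) ≤ M₀ := by exact_mod_cast h0
  have hM' : (M₀ : ℝ) ≤ M := by exact_mod_cast hM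
  exact Real.log_nonneg (le_min (le_max_of_le_right h0') (by linarith))

lemma lg_le {M₀ M : ℕ} (h0 : 0 < M₀) (hM : M₀ ≤ M) (C : Finset V) :
    lg M₀ M C ≤ Real.log (2 * M) := by
  have h0' : (1 : ℝ) ≤ M₀ := by exact_mod_cast h0
  have hM' : (M₀ : ℝ) ≤ M := by exact_mod_cast hM
  exact Real.log_le_log (lt_min (lt_max_of_lt_right (by linarith)) (by linarith)) (min_le_right _ _)

lemma lg_union_sub_ge {M₀ M : ℕ} (h0 : 0 < M₀) {A B : Finset V} (hA : M₀ ≤ A.card)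
    (hAM : A.card < M) (hd : Disjoint A B) :
    min (B.card : ℝ) M₀ / (2 * A.card) ≤ lg M₀ M (A ∪ B) - lg M₀ M A := by
  have h0' : (1 : ℝ) ≤ M₀ := by exact_mod_cast h0
  have hA' : (M₀ : ℝ) ≤ A.card := by exact_mod_cast hA
  have hAM' : (A.card : ℝ) ≤ M := by exact_mod_cast hAM.le
  have hm0 : (0 : ℝ) ≤ min (B.card : ℝ) M₀ := le_min (Nat.cast_nonneg _) (by linarith)
  have hm1 : min (B.card : ℝ) M₀ ≤ A.card := (min_le_right _ _).trans hA'
  have hlA : lg M₀ M A = Real.log A.card := by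
    rw [lg, max_eq_left hA', min_eq_left (by linarith)]
  rw [hlA]
  refine (le_log_add_sub_log (by linarith) hm0 hm1).trans (sub_le_sub_right ?_ _)
  refine Real.log_le_log (by linarith) (le_min (le_max_of_le_left ?_) (by linarith))
  rw [card_union_of_disjoint hd]
  push_cast
  linarith [min_le_left (B.card : ℝ) M₀]

lemma disjoint_clu_del {E S : Finset (Sym2 V)} {A : Finset V} (hS : S ⊆ del E A) {x : V}
    (hx : x ∉ A) : Disjoint A (clu S {x}) := by
  rw [Finset.disjoint_left]
  intro y hy hyx
  rw [mem_clu_singleton] at hyx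
  rcases Relation.ReflTransGen.cases_tail hyx with h | ⟨c, -, h⟩
  · exact hx (h ▸ hy)
  · exact (mem_del.1 (hS h)).2 y hy (Sym2.mem_mk_right c y)

lemma sum_lg_union_sub_ge {G : SimpleGraph V} (hG : ∀ v, (G.neighborSet v).Finite) {d : ℕ}
    (hd : ∀ v, (G.neighborSet v).ncard = d) (hna : 0 < lambda1 G) {p : ℝ} (h0 : 0 ≤ p) (h1 : p ≤ 1)
    {E : Finset (Sym2 V)} {A A' : Finset V} (hA : A' ⊆ A) (t : ℕ)
    (hE : eg G ((nb G)^[t] A') ⊆ E) {M₀ M : ℕ} (hM : 0 < M₀) (hMt : ((d : ℝ) + 1) ^ t ≤ M₀ * p ^ t)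
    {q : ℝ} (hq0 : 0 ≤ q)
    (hq : ∀ x ∈ (nb G)^[t] A', q ≤ Ex p E fun S => if M₀ ≤ (clu S {x}).card then 1 else 0)
    (hAM₀ : M₀ ≤ A.card) (hAM : A.card < M) (hbad : A.card ≤ 2 * A'.card) :
    q / 8 * ((1 + lambda1 G) ^ t - 2) ≤ ∑ z ∈ bd E A, Ex p (del E A)
      (fun S' => lg M₀ M (A ∪ clu S' {z.2}) - lg M₀ M A) := by
  have hApos : (0 : ℝ) < A.card := by exact_mod_cast hM.trans_le hAM₀
  have hgain := gain_ge hG hd h0 h1 hA t hE hM hMt hq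
  have h2 : (∑ z ∈ bd E A, tc p (del E A) M₀ z.2) / (2 * A.card) ≤ ∑ z ∈ bd E A, Ex p (del E A)
      (fun S' => lg M₀ M (A ∪ clu S' {z.2}) - lg M₀ M A) := by
    rw [sum_div]
    refine sum_le_sum fun z hz => ?_
    rw [tc, div_eq_mul_inv, ← Ex_mul_const]
    refine Ex_mono h0 h1 fun S hS => ?_
    rw [← div_eq_mul_inv]
    exact lg_union_sub_ge hM hAM₀ hAM (disjoint_clu_del hS (mem_bd.1 hz).2.1)
  refine le_trans ?_ h2
  rw [le_div_iff₀ (by positivity)]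
  refine le_trans ?_ hgain
  have h3 : (1 + lambda1 G) ^ t * A'.card ≤ ((nb G)^[t] A').card := card_nb_iterate_ge hG hd hna A' t
  have h4 : (((nb G)^[t] A').card : ℝ) ≤ ((nb G)^[t] A' \ A).card + A.card := by
    have := card_le_card_sdiff_add_card (s := (nb G)^[t] A') (t := A)
    exact_mod_cast this
  have h5 : (A.card : ℝ) ≤ 2 * A'.card := by exact_mod_cast hbad
  have h6 : (1 : ℝ) ≤ (1 + lambda1 G) ^ t := one_le_pow₀ (by linarith)
  have h7 : ((1 + lambda1 G) ^ t - 2) / 2 * A.card ≤ ((nb G)^[t] A' \ A).card := by nlinarith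
  nlinarith

lemma clu_inter_eg_subset {G : SimpleGraph V} {v : V} (S : Finset (Sym2 V)) (R : ℕ) :
    clu (S ∩ eg G (bl G v R)) {v} ⊆ bl G v R :=
  clu_subset (inter_subset_right.trans (eg_subset_sym2 _ _))
    (singleton_subset_iff.2 (self_mem_bl G v R))

/-- Either the cluster doubles its size at each of `J` scales, or at some scale most of its vertices
are in the previous ball. -/
lemma exists_bad_scale {G : SimpleGraph V} {v : V} {R : ℕ → ℕ} (hR : Monotone R) {M₀ J : ℕ}
    (S : Finset (Sym2 V)) (h0 : M₀ ≤ (clu (S ∩ eg G (bl G v (R 0))) {v}).card)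
    (hJ : (clu (S ∩ eg G (bl G v (R J))) {v}).card < 2 ^ J * M₀) :
    ∃ j ∈ range J, (clu (S ∩ eg G (bl G v (R (j + 1)))) {v}).card ≤
      2 * (clu (S ∩ eg G (bl G v (R (j + 1)))) {v} ∩ bl G v (R j)).card := by
  by_contra! hcon
  have : ∀ j ≤ J, 2 ^ j * M₀ ≤ (clu (S ∩ eg G (bl G v (R j))) {v}).card := by
    intro j
    induction j with
    | zero => simpa using h0
    | succ j ih =>
      intro hj
      have h1 := ih (by omega)
      have h2 := hcon j (mem_range.2 hj)
      have h3 : clu (S ∩ eg G (bl G v (R j))) {v} ⊆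
          clu (S ∩ eg G (bl G v (R (j + 1)))) {v} ∩ bl G v (R j) :=
        subset_inter (clu_mono (inter_subset_inter_left
          (eg_mono G (bl_mono G v (hR (Nat.le_succ j))))) _) (clu_inter_eg_subset S (R j))
      have h4 := card_le_card h3
      rw [pow_succ, mul_right_comm]
      omega
  exact absurd (this J le_rfl) (not_le.2 hJ)

/-- Growth of clusters under sprinkling: from probability at least `q` for clusters of size `M₀`
in balls of radius `s` to clusters of size `M` in balls of radius `s + J * (s + t)`. -/
lemma rho_growth {G : SimpleGraph V} (hG : ∀ v, (G.neighborSet v).Finite) (ht : IsTransitive G)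
    {d : ℕ} (hd : ∀ v, (G.neighborSet v).ncard = d) (hna : 0 < lambda1 G)
    {a b q q' δ : ℝ} (h0 : 0 ≤ a) (hab : a ≤ b) (h1 : b ≤ 1) (hq0 : 0 ≤ q) (hqq : q ≤ q')
    {s t J M₀ M : ℕ} (hM₀ : 0 < M₀) (hM : M₀ ≤ M) (hJ : M ≤ 2 ^ J * M₀)
    (hMt : ((d : ℝ) + 1) ^ t ≤ M₀ * a ^ t) {v : V} (hρ : q' ≤ rho G a s M₀ v)
    (hΓ0 : 2 ≤ (1 + lambda1 G) ^ t)
    (hΓ : J * Real.log (2 * M) < q / 8 * ((1 + lambda1 G) ^ t - 2) * δ * (b - a)) :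
    q' - δ ≤ rho G b (s + J * (s + t)) M v := by
  by_contra! hcon
  set R : ℕ → ℕ := fun j => s + j * (s + t) with hR
  have hRm : Monotone R := fun i j hij => Nat.add_le_add_left (Nat.mul_le_mul_right _ hij) _
  have hRs : ∀ j, R (j + 1) = R j + t + s := fun j => by simp only [hR]; ring
  set E : ℕ → Finset (Sym2 V) := fun j => eg G (bl G v (R j)) with hE
  have hEm : ∀ i j, i ≤ j → E i ⊆ E j := fun i j hij => eg_mono G (bl_mono G v (hRm hij))
  set Γ := q / 8 * ((1 + lambda1 G) ^ t - 2) with hΓd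
  have hΓnn : 0 ≤ Γ := mul_nonneg (by linarith) (by linarith)
  have hbnd : ∑ j ∈ range J, (Ex b (E (j + 1)) (fun S => lg M₀ M (clu S {v})) -
      Ex a (E (j + 1)) (fun S => lg M₀ M (clu S {v}))) ≤ J * Real.log (2 * M) := by
    have : ∀ j ∈ range J, (Ex b (E (j + 1)) (fun S => lg M₀ M (clu S {v})) -
      Ex a (E (j + 1)) (fun S => lg M₀ M (clu S {v}))) ≤ Real.log (2 * M) := by
      intro j _
      have e1 := Ex_nonneg h0 (hab.trans h1) (E := E (j + 1)) fun S _ => lg_nonneg hM₀ hM (clu S {v})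
      have e2 : Ex b (E (j + 1)) (fun S => lg M₀ M (clu S {v})) ≤ Real.log (2 * M) := by
        conv_rhs => rw [← Ex_const b (E (j + 1)) (Real.log (2 * M))]
        exact Ex_mono (h0.trans hab) h1 fun S _ => lg_le hM₀ hM _
      linarith
    simpa using sum_le_card_nsmul _ _ _ this
  have hder := sum_Ex_sub_ge_of_deriv_ge hab J (fun j => E (j + 1))
    (fun S => lg M₀ M (clu S {v})) (c := Γ * δ) ?_
  · linarith
  intro p hp
  have hp0 : 0 ≤ p := h0.trans hp.1.le
  have hp1 : p ≤ 1 := hp.2.le.trans h1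
  set bad : ℕ → Finset (Sym2 V) → Prop := fun j S =>
    (M₀ ≤ (clu S {v}).card ∧ (clu S {v}).card < M) ∧
      (clu S {v}).card ≤ 2 * (clu S {v} ∩ bl G v (R j)).card with hbad
  have hρp : ∀ x, q ≤ rho G p s M₀ x := fun x => by
    rw [ht.rho_eq hG p s M₀ x v]
    exact hqq.trans (hρ.trans (rho_mono_p G h0 hp.1.le hp1 _ _ _))
  have hstep : ∀ j ∈ range J, Γ * Ex p (E J) (fun S => if bad j (S ∩ E (j + 1)) then 1 else 0) ≤
      ∑ e ∈ E (j + 1), Ex p ((E (j + 1)).erase e)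
        (fun S => lg M₀ M (clu (insert e S) {v}) - lg M₀ M (clu S {v})) := by
    intro j hj
    rw [Ex_restrict p (hEm _ _ (mem_range.1 hj)) fun S => if bad j S then (1 : ℝ) else 0,
      ← Ex_const_mul]
    refine le_trans (Ex_mono hp0 hp1 fun S hS => ?_)
      (deriv_Ex_clu_ge hp0 hp1 (E (j + 1)) {v} (lg_monotone hM₀ hM))
    split_ifs with hb
    · rw [mul_one]
      have hmem : ∀ x ∈ (nb G)^[t] (clu S {v} ∩ bl G v (R j)), inBall G v (R j + t) x := by
        intro x hx
        obtain ⟨y, hy, w, hw⟩ := (mem_nb_iterate hG).1 hx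
        obtain ⟨w', hw'⟩ := (mem_bl hG).1 (mem_inter.1 hy).2
        exact ⟨w'.append w, by rw [SimpleGraph.Walk.length_append]; omega⟩
      refine sum_lg_union_sub_ge hG hd hna hp0 hp1 inter_subset_left t (eg_mono G fun x hx => ?_) hM₀
        (hMt.trans ?_) hq0 (fun x hx => (hρp x).trans ?_) hb.1.1 hb.1.2 hb.2
      · rw [hRs, mem_bl hG]
        obtain ⟨w, hw⟩ := hmem x hx
        exact ⟨w, by omega⟩
      · have := pow_le_pow_left₀ h0 hp.1.le t
        gcongr
      · refine Ex_mono_set hp0 hp1 (eg_mono G fun y hy => ?_) (monotone_ind_card_clu M₀ {x})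
        rw [hRs, mem_bl hG]
        obtain ⟨w, hw⟩ := hmem x hx
        obtain ⟨w', hw'⟩ := (mem_bl hG).1 hy
        exact ⟨w.append w', by rw [SimpleGraph.Walk.length_append]; omega⟩
    · rw [mul_zero]
      exact sum_nonneg fun z _ => Ex_nonneg hp0 hp1 fun S' _ =>
        sub_nonneg.2 (lg_monotone hM₀ hM subset_union_left)
  refine le_trans ?_ (sum_le_sum hstep)
  rw [← mul_sum, ← Ex_sum]
  refine mul_le_mul_of_nonneg_left ?_ hΓnn
  have hlow : q' ≤ Ex p (E J) fun S => if M₀ ≤ (clu (S ∩ E 0) {v}).card then 1 else 0 := by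
    rw [Ex_restrict p (hEm 0 J (Nat.zero_le _)) fun S => if M₀ ≤ (clu S {v}).card then (1 : ℝ) else 0]
    have : E 0 = eg G (bl G v s) := by simp [hE, hR]
    rw [this]
    exact hρ.trans (rho_mono_p G h0 hp.1.le hp1 _ _ _)
  have hup : Ex p (E J) (fun S => if M ≤ (clu S {v}).card then (1 : ℝ) else 0) < q' - δ :=
    (rho_mono_p G hp0 hp.2.le h1 _ _ _).trans_lt hcon
  have hkey : Ex p (E J) (fun S => (if M₀ ≤ (clu (S ∩ E 0) {v}).card then (1 : ℝ) else 0) -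
      if M ≤ (clu S {v}).card then (1 : ℝ) else 0) ≤
      Ex p (E J) fun S => ∑ j ∈ range J, if bad j (S ∩ E (j + 1)) then (1 : ℝ) else 0 := by
    refine Ex_mono hp0 hp1 fun S hS => ?_
    have hnn : ∀ j ∈ range J, (0 : ℝ) ≤ if bad j (S ∩ E (j + 1)) then (1 : ℝ) else 0 :=
      fun j _ => by split_ifs <;> norm_num
    by_cases hc0 : M₀ ≤ (clu (S ∩ E 0) {v}).card
    · by_cases hc : M ≤ (clu S {v}).card
      · rw [if_pos hc0, if_pos hc, sub_self]
        exact sum_nonneg hnn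
      · rw [if_pos hc0, if_neg hc, sub_zero]
        have hSJ : S ∩ E J = S := inter_eq_left.2 hS
        obtain ⟨j, hj, hjb⟩ := exists_bad_scale hRm S hc0
          (by rw [show eg G (bl G v (R J)) = E J from rfl, hSJ]; omega)
        refine le_trans (le_of_eq (if_pos ⟨⟨?_, ?_⟩, hjb⟩).symm) (single_le_sum hnn hj)
        · exact hc0.trans (card_le_card (clu_mono (inter_subset_inter_left
            (hEm 0 (j + 1) (Nat.zero_le _))) _))
        · exact (card_le_card (clu_mono inter_subset_left _)).trans_lt (not_le.1 hc)
    · rw [if_neg hc0]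
      have := sum_nonneg hnn
      split_ifs <;> linarith
  rw [Ex_sub] at hkey
  linarith

end

section
open scoped Classical
open Finset

variable {V : Type*}

lemma eventually_mul_pow_lt {x : ℝ} (hx : 1 < x) (C : ℝ) (k : ℕ) :
    ∀ᶠ n : ℕ in atTop, C * (n : ℝ) ^ k + 2 < x ^ n := by
  have h1 : ∀ D : ℝ, ∀ᶠ n : ℕ in atTop, D * (n : ℝ) ^ k < x ^ n := fun D => by
    have := ((tendsto_pow_const_div_const_pow_of_one_lt k hx).const_mul D)
    rw [mul_zero] at this
    filter_upwards [this.eventually_lt_const one_pos] with n hn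
    rw [← mul_div_assoc, div_lt_one (by positivity)] at hn
    exact hn
  filter_upwards [h1 (2 * C), (tendsto_pow_atTop_atTop_of_one_lt hx).eventually_gt_atTop 4]
    with n h2 h3
  linarith

lemma log_two_mul_two_pow_le (m : ℕ) : Real.log (2 * ((2 ^ m : ℕ) : ℝ)) ≤ m + 1 := by
  have h : (2 : ℝ) * ((2 ^ m : ℕ) : ℝ) = 2 ^ (m + 1) := by push_cast; ring
  rw [h, Real.log_pow]
  have h2 : Real.log 2 ≤ 1 := by linarith [Real.log_two_lt_d9]
  push_cast
  nlinarith [Nat.cast_nonneg (α := ℝ) m]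

lemma add_one_pow_le_of_le {d ℓ : ℕ} {p : ℝ} (hp : 0 < p) (hℓ : ((d : ℝ) + 1) / p ≤ 2 ^ ℓ) (t : ℕ) :
    ((d : ℝ) + 1) ^ t ≤ ((2 ^ (ℓ * t) : ℕ) : ℝ) * p ^ t := by
  rw [div_le_iff₀ hp] at hℓ
  push_cast
  rw [pow_mul, ← mul_pow]
  exact pow_le_pow_left₀ (by positivity) hℓ t

set_option maxHeartbeats 1000000 in
lemma exists_rho_two_pow_two_pow_ge {G : SimpleGraph V} (hG : ∀ v, (G.neighborSet v).Finite)
    (ht : IsTransitive G) {d : ℕ} (hd : ∀ v, (G.neighborSet v).ncard = d) (hna : 0 < lambda1 G)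
    {p₀ p₁ p₂ : ℝ} (h0 : 0 < p₀) (h01 : p₀ < p₁) (h12 : p₁ < p₂) (h1 : p₂ ≤ 1) {v : V}
    (hθ : 0 < theta G p₀ v) :
    ∃ ℓ : ℕ, 1 ≤ ℓ ∧ ∀ᶠ t : ℕ in atTop,
      theta G p₀ v / 4 ≤ rho G p₂ (2 ^ (12 * ℓ * t)) (2 ^ 2 ^ (9 * ℓ * t)) v := by
  obtain ⟨ℓ', hℓ'⟩ := pow_unbounded_of_one_lt (((d : ℝ) + 1) / p₀) one_lt_two
  set ℓ := ℓ' + 1 with hℓd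
  have hℓ : ((d : ℝ) + 1) / p₀ ≤ 2 ^ ℓ :=
    hℓ'.le.trans (pow_le_pow_right₀ one_le_two (Nat.le_succ _))
  have hℓ1 : ((d : ℝ) + 1) / p₁ ≤ 2 ^ ℓ := le_trans (by gcongr) hℓ
  have hℓpos : 1 ≤ ℓ := Nat.le_add_left 1 ℓ'
  set θ := theta G p₀ v with hθd
  have hx : 1 < 1 + lambda1 G := by linarith
  refine ⟨ℓ, hℓpos, ?_⟩
  set C₁ : ℝ := 32 * ℓ ^ 2 / (θ ^ 2 * (p₁ - p₀)) with hC₁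
  set C₂ : ℝ := 128 / (θ ^ 2 * (p₂ - p₁)) with hC₂
  have hd1 : 0 < p₁ - p₀ := by linarith
  have hd2 : 0 < p₂ - p₁ := by linarith
  have hC₂0 : 0 < C₂ := by positivity
  filter_upwards [eventually_mul_pow_lt hx C₁ 4,
    eventually_mul_pow_lt (x := 2) (by norm_num) (2 * ℓ) 2,
    eventually_mul_pow_lt (x := 2) (by norm_num) C₂ 0,
    (tendsto_pow_atTop_atTop_of_one_lt hx).eventually_ge_atTop (2 * 2 ^ (18 * ℓ)),
    eventually_ge_atTop 2] with t ht1 ht2 ht3 ht4 ht5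
  have hlt : t ≤ 2 ^ (ℓ * t) := (Nat.lt_two_pow_self).le.trans
    (Nat.pow_le_pow_right (by norm_num) (Nat.le_mul_of_pos_left t hℓpos))
  have hsq : 1 + 2 * ℓ * t ^ 2 ≤ 2 ^ (ℓ * t) := by
    have h : 1 + 2 * ℓ * t ^ 2 ≤ 2 ^ t := by
      have : ((1 + 2 * ℓ * t ^ 2 : ℕ) : ℝ) ≤ ((2 ^ t : ℕ) : ℝ) := by push_cast; linarith
      exact_mod_cast this
    exact h.trans (Nat.pow_le_pow_right (by norm_num) (Nat.le_mul_of_pos_left t hℓpos))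
  have hstep1 : θ - θ / 2 ≤ rho G p₁ (2 ^ (ℓ * t) + ℓ * t ^ 2 * (2 ^ (ℓ * t) + t))
      (2 ^ (ℓ * t ^ 2)) v := by
    refine rho_growth hG ht hd hna h0.le h01.le (h12.le.trans h1) hθ.le le_rfl (by positivity)
      (Nat.pow_le_pow_right (by norm_num) (Nat.mul_le_mul_left _ (Nat.le_self_pow two_ne_zero t)))
      (Nat.le_mul_of_pos_right _ (by positivity))
      (add_one_pow_le_of_le h0 hℓ t)
      (theta_le_rho hG h0.le (h01.le.trans (h12.le.trans h1)) v _) ?_ ?_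
    · have : 0 ≤ C₁ * (t : ℝ) ^ 4 := by positivity
      linarith
    · have hlog := log_two_mul_two_pow_le (ℓ * t ^ 2)
      have hc : C₁ * (θ ^ 2 * (p₁ - p₀)) = 32 * ℓ ^ 2 := div_mul_cancel₀ _ (by positivity)
      have h3 : 0 < θ ^ 2 * (p₁ - p₀) := by positivity
      have h4 : (C₁ * t ^ 4) * (θ ^ 2 * (p₁ - p₀)) <
          ((1 + lambda1 G) ^ t - 2) * (θ ^ 2 * (p₁ - p₀)) :=
        mul_lt_mul_of_pos_right (by linarith) h3
      have h5 : (1 : ℝ) ≤ ((ℓ * t ^ 2 : ℕ) : ℝ) := by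
        exact_mod_cast Nat.mul_pos hℓpos (by positivity)
      have h6 : ((ℓ * t ^ 2 : ℕ) : ℝ) * Real.log (2 * ((2 ^ (ℓ * t ^ 2) : ℕ) : ℝ)) ≤
          2 * ((ℓ * t ^ 2 : ℕ) : ℝ) ^ 2 := by nlinarith
      refine h6.trans_lt ?_
      push_cast
      have h7 : (C₁ * t ^ 4) * (θ ^ 2 * (p₁ - p₀)) = 32 * ℓ ^ 2 * t ^ 4 := by rw [← hc]; ring
      linarith
  set R₁ := 2 ^ (ℓ * t) + ℓ * t ^ 2 * (2 ^ (ℓ * t) + t) with hR₁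
  have hR₁le : R₁ ≤ 2 ^ (2 * ℓ * t) := by
    have : (2 : ℕ) ^ (2 * ℓ * t) = 2 ^ (ℓ * t) * 2 ^ (ℓ * t) := by rw [← pow_add]; ring_nf
    rw [this, hR₁]
    calc 2 ^ (ℓ * t) + ℓ * t ^ 2 * (2 ^ (ℓ * t) + t)
        ≤ 2 ^ (ℓ * t) + ℓ * t ^ 2 * (2 ^ (ℓ * t) + 2 ^ (ℓ * t)) := by gcongr
      _ = 2 ^ (ℓ * t) * (1 + 2 * ℓ * t ^ 2) := by ring
      _ ≤ _ := by gcongr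
  set J := 2 ^ (9 * ℓ * t) with hJ
  have hJ1 : ℓ * t ^ 2 ≤ J := by
    have : 2 ^ (ℓ * t) ≤ J := Nat.pow_le_pow_right (by norm_num) (by nlinarith)
    nlinarith
  have hstep2 : θ / 2 - θ / 4 ≤ rho G p₂ (R₁ + J * (R₁ + t ^ 2)) (2 ^ J) v := by
    refine rho_growth hG ht hd hna (h0.trans h01).le h12.le h1 (q := θ / 2) (by positivity)
      le_rfl (by positivity) (Nat.pow_le_pow_right (by norm_num) hJ1)
      (Nat.le_mul_of_pos_right _ (by positivity))
      (add_one_pow_le_of_le (h0.trans h01) hℓ1 (t ^ 2)) (by linarith) ?_ ?_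
    all_goals
      have hpow : C₂ * 2 ^ (18 * ℓ * t) + 2 < (1 + lambda1 G) ^ (t ^ 2) := by
        rw [pow_two t, pow_mul (1 + lambda1 G)]
        refine lt_of_lt_of_le ?_ (pow_le_pow_left₀ (by positivity) ht4 t)
        rw [mul_pow, ← pow_mul]
        have : (1 : ℝ) ≤ 2 ^ (18 * ℓ * t) := one_le_pow₀ one_le_two
        rw [pow_zero, mul_one] at ht3
        nlinarith
    · have : 0 ≤ C₂ * 2 ^ (18 * ℓ * t) := by positivity
      linarith
    · have hlog := log_two_mul_two_pow_le J
      have hc : C₂ * (θ ^ 2 * (p₂ - p₁)) = 128 := div_mul_cancel₀ _ (by positivity)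
      have h3 : 0 < θ ^ 2 * (p₂ - p₁) := by positivity
      have h4 : (C₂ * 2 ^ (18 * ℓ * t)) * (θ ^ 2 * (p₂ - p₁)) <
          ((1 + lambda1 G) ^ (t ^ 2) - 2) * (θ ^ 2 * (p₂ - p₁)) :=
        mul_lt_mul_of_pos_right (by linarith) h3
      have h5 : (1 : ℝ) ≤ (J : ℝ) := by exact_mod_cast Nat.one_le_two_pow
      have h6 : (J : ℝ) * Real.log (2 * ((2 ^ J : ℕ) : ℝ)) ≤ 2 * (J : ℝ) ^ 2 := by nlinarith
      refine h6.trans_lt ?_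
      have h8 : (J : ℝ) ^ 2 = 2 ^ (18 * ℓ * t) := by
        rw [hJ]; push_cast; rw [← pow_mul]; ring_nf
      have h7 : (C₂ * 2 ^ (18 * ℓ * t)) * (θ ^ 2 * (p₂ - p₁)) = 128 * 2 ^ (18 * ℓ * t) := by
        rw [← hc]; ring
      rw [h8]
      linarith
  have hR₂ : R₁ + J * (R₁ + t ^ 2) ≤ 2 ^ (12 * ℓ * t) := by
    have h1 : (2 : ℕ) ^ (12 * ℓ * t) = 2 ^ (ℓ * t) * (J * 2 ^ (2 * ℓ * t)) := by
      rw [hJ, ← pow_add, ← pow_add]; ring_nf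
    have h2 : t ^ 2 ≤ 2 ^ (2 * ℓ * t) := by
      have : (2 : ℕ) ^ (2 * ℓ * t) = 2 ^ (ℓ * t) * 2 ^ (ℓ * t) := by rw [← pow_add]; ring_nf
      nlinarith
    have h3 : 3 ≤ 2 ^ (ℓ * t) := by nlinarith
    have hJ0 : 1 ≤ J := Nat.one_le_two_pow
    rw [h1]
    calc R₁ + J * (R₁ + t ^ 2)
        ≤ J * 2 ^ (2 * ℓ * t) + J * (2 ^ (2 * ℓ * t) + 2 ^ (2 * ℓ * t)) := by
          gcongr
          nlinarith
      _ = 3 * (J * 2 ^ (2 * ℓ * t)) := by ring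
      _ ≤ _ := by gcongr
  have := rho_mono_radius G ((h0.trans h01).trans h12).le h1 hR₂ (2 ^ J) v
  linarith

/-- In a supercritical nonamenable transitive graph, the cluster in a ball of radius `r` has size
exponential in a power of `r`, with probability bounded below. -/
lemma exists_rho_two_pow_ge {G : SimpleGraph V} (hG : ∀ v, (G.neighborSet v).Finite)
    (ht : IsTransitive G) {d : ℕ} (hd : ∀ v, (G.neighborSet v).ncard = d) (hna : 0 < lambda1 G)
    {p₀ p₁ p₂ : ℝ} (h0 : 0 < p₀) (h01 : p₀ < p₁) (h12 : p₁ < p₂) (h1 : p₂ ≤ 1) {v : V}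
    (hθ : 0 < theta G p₀ v) :
    ∃ q : ℝ, 0 < q ∧ ∀ᶠ r : ℕ in atTop, ∃ J : ℕ, r ^ 2 ≤ J ^ 3 ∧ q ≤ rho G p₂ r (2 ^ J) v := by
  have hp2 : 0 ≤ p₂ := ((h0.trans h01).trans h12).le
  obtain ⟨ℓ, hℓ, hev⟩ := exists_rho_two_pow_two_pow_ge hG ht hd hna h0 h01 h12 h1 hθ
  obtain ⟨T, hT⟩ := eventually_atTop.1 hev
  refine ⟨theta G p₀ v / 4, by positivity, ?_⟩
  have hlog : Tendsto (fun r => Nat.log 2 r / (12 * ℓ)) atTop atTop :=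
    (Nat.tendsto_div_const_atTop (by omega)).comp
      (tendsto_atTop.2 fun b => (eventually_ge_atTop (2 ^ b)).mono fun r hr =>
        Nat.le_log_of_pow_le one_lt_two hr)
  filter_upwards [hlog.eventually_ge_atTop (max T 8), eventually_ge_atTop 1] with r hr hr1
  obtain ⟨t, htd⟩ : ∃ t, t = Nat.log 2 r / (12 * ℓ) := ⟨_, rfl⟩
  rw [← htd] at hr
  have h8 : 8 ≤ t := (le_max_right _ _).trans hr
  have hle : 12 * ℓ * t ≤ Nat.log 2 r := htd ▸ Nat.mul_div_le _ _
  have hlt : Nat.log 2 r < 12 * ℓ * (t + 1) := htd ▸ Nat.lt_mul_div_succ _ (by omega)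
  refine ⟨2 ^ (9 * ℓ * t), ?_, (hT t ((le_max_left _ _).trans hr)).trans ?_⟩
  · have h1 : r ≤ 2 ^ (12 * ℓ * (t + 1)) := (Nat.lt_pow_of_log_lt (by norm_num) hlt).le
    calc r ^ 2 ≤ (2 ^ (12 * ℓ * (t + 1))) ^ 2 := Nat.pow_le_pow_left h1 2
      _ = 2 ^ (12 * ℓ * (t + 1) * 2) := (pow_mul _ _ _).symm
      _ ≤ 2 ^ (9 * ℓ * t * 3) := Nat.pow_le_pow_right (by norm_num) (by nlinarith)
      _ = _ := pow_mul _ _ _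
  · refine rho_mono_radius G hp2 h1 ?_ _ v
    exact (Nat.pow_le_pow_right two_pos hle).trans (Nat.pow_log_le_self 2 (by omega))

end

section
open scoped Classical
open Finset

variable {V : Type*}

lemma growth_rate {x C : ℝ} {ℓ u : ℕ} (hx : 0 ≤ x) (hu1 : 1 ≤ u)
    (hu : (24 * ℓ : ℝ) ^ 9 * (2 + C) < u) (hlam : 1 ≤ x ^ 4 * (24 * ℓ * u : ℝ) ^ 3) (i : ℕ) :
    2 + C * (16 ^ i * u ^ 2) < (1 + x) ^ (2 ^ i * (12 * u)) := by
  have hℓ : (0 : ℝ) < 24 * ℓ := by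
    rcases Nat.eq_zero_or_pos ℓ with rfl | h
    · norm_num at hlam
    · positivity
  have hu1' : (1 : ℝ) ≤ u := by exact_mod_cast hu1
  have h16 : (1 : ℝ) ≤ 16 ^ i := one_le_pow₀ (by norm_num)
  have h1 : (2 ^ i * u * x) ^ 12 ≤ (1 + x) ^ (2 ^ i * (12 * u)) := by
    have hb := one_add_mul_le_pow (by linarith : (-2 : ℝ) ≤ x) (2 ^ i * u)
    rw [show 2 ^ i * (12 * u) = 2 ^ i * u * 12 by ring, pow_mul]
    refine pow_le_pow_left₀ (by positivity) (le_trans ?_ hb) 12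
    push_cast
    linarith
  have h2 : (1 : ℝ) ≤ x ^ 12 * ((24 * ℓ) ^ 9 * u ^ 9) := by
    calc (1 : ℝ) ≤ (x ^ 4 * (24 * ℓ * u) ^ 3) ^ 3 := one_le_pow₀ hlam
      _ = _ := by ring
  have h3 : (16 ^ i * u ^ 3 : ℝ) ≤ (24 * ℓ) ^ 9 * (2 ^ i * u * x) ^ 12 := by
    have h4 : (16 : ℝ) ^ i ≤ (2 ^ i) ^ 12 := by
      rw [← pow_mul, mul_comm, pow_mul]
      exact pow_le_pow_left₀ (by norm_num) (by norm_num) i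
    calc (16 ^ i * u ^ 3 : ℝ) ≤ (2 ^ i) ^ 12 * u ^ 3 * (x ^ 12 * ((24 * ℓ) ^ 9 * u ^ 9)) := by
          refine le_trans ?_ (le_mul_of_one_le_right (by positivity) h2)
          gcongr
      _ = _ := by ring
  have h5 : (24 * ℓ : ℝ) ^ 9 * (2 + C * (16 ^ i * u ^ 2)) < 16 ^ i * u ^ 3 := by
    have h7 : (1 : ℝ) ≤ 16 ^ i * u ^ 2 := one_le_mul_of_one_le_of_one_le h16 (one_le_pow₀ hu1')
    have h6 : 2 + C * (16 ^ i * u ^ 2) ≤ (2 + C) * (16 ^ i * u ^ 2) := by nlinarith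
    calc (24 * ℓ : ℝ) ^ 9 * (2 + C * (16 ^ i * u ^ 2))
        ≤ (24 * ℓ : ℝ) ^ 9 * ((2 + C) * (16 ^ i * u ^ 2)) := by gcongr
      _ = (24 * ℓ : ℝ) ^ 9 * (2 + C) * (16 ^ i * u ^ 2) := by ring
      _ < u * (16 ^ i * u ^ 2) := mul_lt_mul_of_pos_right hu (by linarith)
      _ = _ := by ring
  have h6 : 2 + C * (16 ^ i * u ^ 2) < (2 ^ i * u * x) ^ 12 :=
    lt_of_mul_lt_mul_left (h5.trans_le h3) (by positivity)
  exact h6.trans_le h1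

/-- Large enough clusters in a ball with probability at least `q` lead to percolation after
sprinkling. -/
lemma half_le_theta_of_rho_two_pow {G : SimpleGraph V} (hG : ∀ v, (G.neighborSet v).Finite)
    (ht : IsTransitive G) {d : ℕ} (hd : ∀ v, (G.neighborSet v).ncard = d) (hna : 0 < lambda1 G)
    {a b q : ℝ} (h0 : 0 < a) (hab : a < b) (h1 : b ≤ 1) (hq : 0 < q) {ℓ u s : ℕ}
    (hℓ : ((d : ℝ) + 1) / a ≤ 2 ^ ℓ) (hu1 : 1 ≤ u)
    (hu : (24 * ℓ : ℝ) ^ 9 * (2 + 55296 * ℓ ^ 2 / (q ^ 2 * (b - a))) < u)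
    (hlam : 1 ≤ lambda1 G ^ 4 * (24 * ℓ * u : ℝ) ^ 3) {v : V}
    (hρ : q ≤ rho G a s (2 ^ (ℓ * (12 * u))) v) : q / 2 ≤ theta G b v := by
  have hba : 0 < b - a := by linarith
  have hgr := growth_rate hna.le (C := 55296 * ℓ ^ 2 / (q ^ 2 * (b - a))) hu1 hu hlam
  have hℓ1 : 1 ≤ ℓ := by
    by_contra! h
    obtain rfl : ℓ = 0 := by omega
    norm_num at hlam
  set p : ℕ → ℝ := fun i => a + (b - a) * (1 - (1 / 2) ^ i) with hp
  set J : ℕ → ℕ := fun i => ℓ * (2 ^ i * (12 * u)) with hJ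
  have hhalf : ∀ i, (0 : ℝ) < (1 / 2) ^ i ∧ ((1 : ℝ) / 2) ^ i ≤ 1 := fun i =>
    ⟨by positivity, pow_le_one₀ (by norm_num) (by norm_num)⟩
  have hpa : ∀ i, a ≤ p i := fun i => by
    have := hhalf i
    simp only [hp]
    nlinarith
  have hpb : ∀ i, p i ≤ b := fun i => by
    have := hhalf i
    simp only [hp]
    nlinarith
  have hpsub : ∀ i, p (i + 1) - p i = (b - a) / 2 * (1 / 2) ^ i := fun i => by
    simp only [hp]
    rw [pow_succ]
    ring
  have hiter : ∀ i, ∃ s, q / 2 * (1 + (1 / 2) ^ i) ≤ rho G (p i) s (2 ^ J i) v := by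
    intro i
    induction i with
    | zero => exact ⟨s, by simpa [hp, hJ, one_add_one_eq_two] using hρ⟩
    | succ i ih =>
      obtain ⟨s, hs⟩ := ih
      refine ⟨s + J i * (s + 2 ^ i * (12 * u)), ?_⟩
      have hJs : J (i + 1) = J i + J i := by simp only [hJ, pow_succ]; ring
      have hJ1 : 1 ≤ J i := by simp only [hJ]; exact Nat.mul_pos hℓ1 (by positivity)
      have heq : q / 2 * (1 + (1 / 2) ^ (i + 1)) =
          q / 2 * (1 + (1 / 2) ^ i) - q / 4 * (1 / 2) ^ i := by rw [pow_succ]; ring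
      rw [heq]
      have h16 : (0 : ℝ) ≤ 16 ^ i * u ^ 2 := by positivity
      have hC0 : (0 : ℝ) ≤ 55296 * ℓ ^ 2 / (q ^ 2 * (b - a)) := by positivity
      refine rho_growth hG ht hd hna (h0.le.trans (hpa i)) ?_ ((hpb _).trans h1) (q := q / 2)
        (by positivity) ?_ (by positivity) (Nat.pow_le_pow_right two_pos (by change J i ≤ J (i + 1); omega))
        (by rw [hJs, pow_add]) (add_one_pow_le_of_le (h0.trans_le (hpa i)) ?_ _) hs ?_ ?_
      · rw [← sub_nonneg, hpsub]
        positivity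
      · have := (hhalf i).1
        nlinarith
      · refine le_trans ?_ hℓ
        have := hpa i
        gcongr
      · nlinarith [hgr i]
      · rw [hpsub]
        have hlog := log_two_mul_two_pow_le (J (i + 1))
        have hJ1' : (1 : ℝ) ≤ J i := by exact_mod_cast hJ1
        have hJs' : (J (i + 1) : ℝ) = J i + J i := by exact_mod_cast hJs
        have h6 : (J i : ℝ) * Real.log (2 * ((2 ^ J (i + 1) : ℕ) : ℝ)) ≤ 3 * (J i : ℝ) ^ 2 := by
          rw [hJs'] at hlog
          nlinarith
        refine h6.trans_lt ?_
        have hx : 55296 * ℓ ^ 2 / (q ^ 2 * (b - a)) * (16 ^ i * u ^ 2) <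
          (1 + lambda1 G) ^ (2 ^ i * (12 * u)) - 2 := by linarith [hgr i]
        set X := (1 + lambda1 G) ^ (2 ^ i * (12 * u)) - 2
        have h4 : ((1 : ℝ) / 2) ^ i * (1 / 2) ^ i * 4 ^ i = 1 := by
          rw [← mul_pow, ← mul_pow]; norm_num
        have hJsq : (J i : ℝ) ^ 2 = 144 * ℓ ^ 2 * (4 ^ i * u ^ 2) := by
          have : (4 : ℝ) ^ i = 2 ^ i * 2 ^ i := by rw [← mul_pow]; norm_num
          simp only [hJ]
          push_cast
          rw [this]
          ring
        have h16' : (16 : ℝ) ^ i = 4 ^ i * 4 ^ i := by rw [← mul_pow]; norm_num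
        have hpos : 0 < q ^ 2 * (b - a) / 128 * ((1 / 2) ^ i * (1 / 2) ^ i) := by
          have := (hhalf i).1
          positivity
        have := mul_lt_mul_of_pos_right hx hpos
        calc 3 * (J i : ℝ) ^ 2
            = 432 * ℓ ^ 2 * (4 ^ i * u ^ 2) * (((1 : ℝ) / 2) ^ i * (1 / 2) ^ i * 4 ^ i) := by
              rw [hJsq, h4]; ring
          _ = 55296 * ℓ ^ 2 / (q ^ 2 * (b - a)) * (16 ^ i * u ^ 2) *
              (q ^ 2 * (b - a) / 128 * ((1 / 2) ^ i * (1 / 2) ^ i)) := by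
              rw [h16']; field_simp; ring
          _ < _ := this
          _ = _ := by ring
  refine le_theta_of_le_rho hG (h0.le.trans hab.le) h1 fun M => ?_
  obtain ⟨s, hs⟩ := hiter M
  refine ⟨s, ?_⟩
  have hM : M ≤ 2 ^ J M := by
    refine Nat.lt_two_pow_self.le.trans (Nat.pow_le_pow_right two_pos ?_)
    calc M ≤ 2 ^ M := Nat.lt_two_pow_self.le
      _ ≤ 2 ^ M * (12 * u) := Nat.le_mul_of_pos_right _ (by omega)
      _ ≤ J M := Nat.le_mul_of_pos_left _ hℓ1
  have h3 := rho_mono_p G (h0.le.trans (hpa M)) (hpb M) h1 s (2 ^ J M) v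
  have h4 := rho_anti G (h0.le.trans hab.le) h1 s hM v
  have h5 := (hhalf M).1
  nlinarith

end

section
open scoped Classical
open Finset

variable {V : Type*}

lemma eventually_lt_pc {Vn : ℕ → Type*} {W : Type*} {G : ∀ n, SimpleGraph (Vn n)}
    {H : SimpleGraph W} (hGconn : ∀ n, (G n).Connected) (hGinf : ∀ n, Infinite (Vn n))
    (hG : ∀ n, ∀ v : Vn n, ((G n).neighborSet v).Finite) (hGt : ∀ n, IsTransitive (G n))
    (hHconn : H.Connected) (hHinf : Infinite W) (hH : ∀ w : W, (H.neighborSet w).Finite)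
    (hconv : ConvergesLocally G H) {a : ℝ} (ha : a < pc H) : ∀ᶠ n in atTop, a < pc (G n) := by
  rcases lt_or_ge a 0 with h0 | h0
  · exact Eventually.of_forall fun n => h0.trans_le (pc_nonneg _)
  obtain ⟨b, hab, hb⟩ := exists_between ha
  obtain ⟨c, hbc, hc⟩ := exists_between hb
  have hc1 : c ≤ 1 := hc.le.trans (pc_le_one hH hHconn hHinf)
  have hc0 : 0 ≤ c := h0.trans (hab.le.trans hbc.le)
  obtain ⟨w⟩ := hHconn.nonempty
  have hM : ∃ M, ∀ s, rho H c s M w < (c - b) / 2 := by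
    by_contra! hcon
    have h1 := le_theta_of_le_rho hH hc0 hc1 hcon
    have h2 := pc_le_of_theta_pos hc0 hc1 ((by linarith : 0 < (c - b) / 2).trans_le h1)
    linarith
  obtain ⟨M, hM⟩ := hM
  obtain ⟨N, hN⟩ := hconv (M + 1)
  filter_upwards [eventually_ge_atTop N] with n hn
  by_contra! hcon
  obtain ⟨v⟩ := (hGconn n).nonempty
  have hθ := theta_pos_of_pc_lt (hG n) (hGconn n) (hGinf n) (hGt n) (hcon.trans_lt hab)
    (hbc.le.trans hc1) v
  have h1 := half_sub_le_rho (hG n) (hGt n) (h0.trans hab.le) hbc.le hc1 hθ M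
  rw [(hN n hn v w).rho_eq (hG n) hH c le_rfl] at h1
  have h2 := rho_anti H hc0 hc1 (M + 1) (Nat.le_succ M) w
  linarith [hM (M + 1)]

lemma eventually_pc_lt {Vn : ℕ → Type*} {W : Type*} {G : ∀ n, SimpleGraph (Vn n)}
    {H : SimpleGraph W} (hGconn : ∀ n, (G n).Connected) (hGinf : ∀ n, Infinite (Vn n))
    (hG : ∀ n, ∀ v : Vn n, ((G n).neighborSet v).Finite) (hGt : ∀ n, IsTransitive (G n))
    (hGna : ∀ n, 0 < lambda1 (G n))
    (hHconn : H.Connected) (hHinf : Infinite W) (hH : ∀ w : W, (H.neighborSet w).Finite)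
    (hHt : IsTransitive H) (hHna : 0 < lambda1 H) {d : ℕ}
    (hHreg : ∀ w : W, (H.neighborSet w).ncard = d) (hconv : ConvergesLocally G H)
    {r : ℕ → ℕ} (hr : ∀ n, ∀ (vn : Vn n) (w : W), BallIso (G n) H vn w (r n))
    (hdiv : Tendsto (fun n => lambda1 (G n) ^ 2 * (r n : ℝ)) atTop atTop)
    {a : ℝ} (ha : pc H < a) : ∀ᶠ n in atTop, pc (G n) < a := by
  rcases lt_or_ge 1 a with h1 | h1
  · exact Eventually.of_forall fun n => (pc_le_one (hG n) (hGconn n) (hGinf n)).trans_lt h1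
  obtain ⟨p₀, h0, ha0⟩ := exists_between ha
  obtain ⟨p₁, h01, ha1⟩ := exists_between ha0
  obtain ⟨p₂, h12, ha2⟩ := exists_between ha1
  obtain ⟨p₃, h23, ha3⟩ := exists_between ha2
  obtain ⟨w⟩ := hHconn.nonempty
  have hp0 : 0 < p₀ := (pc_nonneg H).trans_lt h0
  have hp2 : 0 < p₂ := hp0.trans (h01.trans h12)
  have hθ := theta_pos_of_pc_lt hH hHconn hHinf hHt h0 (ha0.le.trans h1) w
  obtain ⟨q, hq, hqr⟩ := exists_rho_two_pow_ge hH hHt hHreg hHna hp0 h01 h12 (ha2.le.trans h1) hθ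
  obtain ⟨ℓ', hℓ'⟩ := pow_unbounded_of_one_lt (((d : ℝ) + 1) / p₂) one_lt_two
  set ℓ := ℓ' + 1 with hℓd
  have hℓ : ((d : ℝ) + 1) / p₂ ≤ 2 ^ ℓ :=
    hℓ'.le.trans (pow_le_pow_right₀ one_le_two (Nat.le_succ _))
  obtain ⟨U, hU⟩ := exists_nat_gt ((24 * ℓ : ℝ) ^ 9 * (2 + 55296 * ℓ ^ 2 / (q ^ 2 * (p₃ - p₂))))
  set K := 12 * ℓ * (U + 1) with hK
  have hK1 : 1 ≤ K := Nat.mul_pos (by omega) (by omega)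
  have hreg : ∀ᶠ n in atTop, ∀ v : Vn n, ((G n).neighborSet v).ncard = d := by
    obtain ⟨N, hN⟩ := hconv 1
    filter_upwards [eventually_ge_atTop N] with n hn v
    have := (hN n hn v w).card_neighbors (hG n) hH le_rfl
    rw [card_bl_one (hG n), card_bl_one hH, hHreg] at this
    omega
  have hlam : ∀ᶠ n in atTop, lambda1 (G n) ≤ 1 := hreg.mono fun n hn =>
    have := (hGconn n).nonempty
    lambda1_le_one (hG n) hn (hGna n)
  have hr' : Tendsto r atTop atTop := by
    refine tendsto_natCast_atTop_iff.1 (tendsto_atTop_mono' (α := ℕ) (β := ℝ) atTop ?_ hdiv)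
    filter_upwards [hlam] with n hn
    exact mul_le_of_le_one_left (Nat.cast_nonneg _) (pow_le_one₀ (hGna n).le hn)
  filter_upwards [hreg, hdiv.eventually_ge_atTop 1, hr'.eventually hqr,
    hr'.eventually_ge_atTop (K ^ 2)] with n hn hdn hJn hKn
  obtain ⟨J, hJ, hρ⟩ := hJn
  obtain ⟨v⟩ := (hGconn n).nonempty
  have hJK : K ≤ J := by
    by_contra! hlt
    have h2 : J ^ 3 < K ^ 3 := Nat.pow_lt_pow_left hlt (by norm_num)
    have h3 : K ^ 3 ≤ (K ^ 2) ^ 2 := by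
      rw [← pow_mul]
      exact Nat.pow_le_pow_right hK1 (by norm_num)
    have h4 : (K ^ 2) ^ 2 ≤ r n ^ 2 := Nat.pow_le_pow_left hKn 2
    omega
  obtain ⟨u, hu⟩ : ∃ u, u = J / (12 * ℓ) := ⟨_, rfl⟩
  have hu1 : U + 1 ≤ u := by
    rw [hu, Nat.le_div_iff_mul_le (by omega), mul_comm]
    exact hJK
  have hle : ℓ * (12 * u) ≤ J := by
    have := Nat.mul_div_le J (12 * ℓ)
    rw [← hu] at this
    linarith
  have hlt : J ≤ 24 * ℓ * u := by
    have := Nat.lt_mul_div_succ J (b := 12 * ℓ) (by omega)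
    rw [← hu] at this
    nlinarith
  have hlam4 : 1 ≤ lambda1 (G n) ^ 4 * (24 * ℓ * u : ℝ) ^ 3 := by
    have h2 : (r n : ℝ) ^ 2 ≤ (J : ℝ) ^ 3 := by exact_mod_cast hJ
    have h3 : (J : ℝ) ^ 3 ≤ (24 * ℓ * u : ℝ) ^ 3 :=
      pow_le_pow_left₀ (Nat.cast_nonneg _) (by exact_mod_cast hlt) 3
    calc (1 : ℝ) ≤ (lambda1 (G n) ^ 2 * r n) ^ 2 := one_le_pow₀ hdn
      _ = lambda1 (G n) ^ 4 * (r n : ℝ) ^ 2 := by ring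
      _ ≤ _ := by gcongr; exact h2.trans h3
  have hρn : q ≤ rho (G n) p₂ (r n) (2 ^ (ℓ * (12 * u))) v := by
    rw [(hr n v w).rho_eq (hG n) hH p₂ le_rfl]
    exact hρ.trans (rho_anti H hp2.le (ha2.le.trans h1) _ (Nat.pow_le_pow_right two_pos hle) w)
  have hfin := half_le_theta_of_rho_two_pow (hG n) (hGt n) hn (hGna n) hp2 h23 (ha3.le.trans h1) hq hℓ
    (by omega) (hU.trans (by exact_mod_cast hu1)) hlam4 hρn
  exact (pc_le_of_theta_pos (hp2.trans h23).le (ha3.le.trans h1)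
    ((half_pos hq).trans_le hfin)).trans_lt ha3

end

/-- Remark 2 of the paper.  If `{G n}` is a sequence of nonamenable
transitive locally finite infinite connected graphs converging locally to a nonamenable
transitive locally finite infinite connected graph `H` satisfying Assumption 1, and if
`r n` are radii for which all `(r n)`-balls of `G n` are rooted-isomorphic to those of `H`
with `λ₁(G n)² · r n → ∞`, then `p_c(G n) → p_c(H)`. -/
theorem pc_locality_of_lambda_sq_radius_tendsto_atTop
    {Vn : ℕ → Type*} {W : Type*} (G : ∀ n, SimpleGraph (Vn n)) (H : SimpleGraph W)
    (hGconn : ∀ n, (G n).Connected) (hGinf : ∀ n, Infinite (Vn n))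
    (hGlf : ∀ n, ∀ v : Vn n, ((G n).neighborSet v).Finite)
    (hGtrans : ∀ n, IsTransitive (G n))
    (hGna : ∀ n, 0 < lambda1 (G n))
    (hHconn : H.Connected) (hHinf : Infinite W)
    (hHlf : ∀ w : W, (H.neighborSet w).Finite) (hHtrans : IsTransitive H)
    (hHna : 0 < lambda1 H)
    (d : ℕ) (hHreg : ∀ w : W, (H.neighborSet w).ncard = d)
    (hconv : ConvergesLocally G H)
    (hA1 : Assumption1i H d) (hA2 : Assumption1ii H)
    (r : ℕ → ℕ)
    (hr : ∀ n, ∀ (vn : Vn n) (w : W), BallIso (G n) H vn w (r n))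
    (hdiv : Filter.Tendsto (fun n => lambda1 (G n) ^ 2 * (r n : ℝ))
      Filter.atTop Filter.atTop) :
    Filter.Tendsto (fun n => pc (G n)) Filter.atTop (nhds (pc H)) := by
  rw [tendsto_order]
  exact ⟨fun a ha => eventually_lt_pc hGconn hGinf hGlf hGtrans hHconn hHinf hHlf hconv ha,
    fun a ha => eventually_pc_lt hGconn hGinf hGlf hGtrans hGna hHconn hHinf hHlf hHtrans hHna
      hHreg hconv hr hdiv ha⟩

end Loc
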